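/- In the two-default Cox model (N = 2): let Z = (Z_u)_{u≥0} be a nonnegative, bounded, (𝓕_t)-progressively measurable process on Ω, fix 0 ≤ t ≤ s, and suppose g : [0,∞) × Ω → ℝ is 𝓑([0,∞)) ⊗ 𝓕-measurable and such that for every u ∈ [0, t], g(u, ·) is a version of E^P[ ∫_{t−u}^{s−u} Z_{u+x} e^{−∫_0^x λ̃²_w dw} λ̃²_x dx | 𝓕_t ]. Then P̃-almost surely: E^{P̃}[ 1_{{t < τ_2 ≤ s}} Z_{τ_2} | 𝒢_t^{(2)} ] = 1_{{τ_1 > t}} e^{∫_0^t λ̃¹_v dv} E^P[ ∫_t^s ( ∫_0^{s−y} Z_{y+x} e^{−∫_0^x λ̃²_w dw} λ̃²_x dx ) e^{−∫_0^y λ̃¹_w dw} λ̃¹_y dy | 𝓕_t ] + 1_{{τ_1 ≤ t < τ_2}} e^{∫_0^{t−τ_1} λ̃²_v dv} g(τ_1, ·). -/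

import Mathlib

open MeasureTheory ProbabilityTheory Set

open scoped ENNReal Topology

/-! ### Hazard rates and the induced first hitting times -/

/-- The integrated hazard rate `∫_0^u lam`. -/
noncomputable def cumHazard (lam : ℝ → ℝ) (u : ℝ) : ℝ := ∫ v in Ioc (0:ℝ) u, lam v

/-- The density `e^{-∫_0^x lam} lam x` of the default time with hazard rate `lam`. -/
noncomputable def hazardDensity (lam : ℝ → ℝ) (x : ℝ) : ℝ :=
  Real.exp (-cumHazard lam x) * lam x

/-- The first time at which the integrated hazard rate reaches the level `e`. -/
noncomputable def hitTime (lam : ℝ → ℝ) (e : ℝ) : ℝ :=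
  sInf {u : ℝ | 0 < u ∧ e ≤ cumHazard lam u}

/-- A nonnegative, locally integrable rate with infinite total mass. -/
structure IsHazard (lam : ℝ → ℝ) : Prop where
  measurable : Measurable lam
  nonneg : ∀ v, 0 ≤ lam v
  lintegral_lt_top : ∀ t : ℝ, ∫⁻ v in Ioc (0:ℝ) t, ENNReal.ofReal (lam v) < ⊤
  lintegral_eq_top : ∫⁻ v in Ioi (0:ℝ), ENNReal.ofReal (lam v) = ⊤

lemma cumHazard_nonneg {lam : ℝ → ℝ} (h : ∀ v, 0 ≤ lam v) (u : ℝ) : 0 ≤ cumHazard lam u :=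
  integral_nonneg h

lemma hazardDensity_nonneg {lam : ℝ → ℝ} (h : ∀ v, 0 ≤ lam v) (x : ℝ) :
    0 ≤ hazardDensity lam x :=
  mul_nonneg (Real.exp_pos _).le (h x)

lemma hitTime_nonneg (lam : ℝ → ℝ) (e : ℝ) : 0 ≤ hitTime lam e :=
  Real.sInf_nonneg fun _ hu => hu.1.le

lemma cumHazard_eq_toReal {lam : ℝ → ℝ} (hm : Measurable lam) (h : ∀ v, 0 ≤ lam v) (u : ℝ) :
    cumHazard lam u = (∫⁻ v in Ioc (0:ℝ) u, ENNReal.ofReal (lam v)).toReal :=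
  integral_eq_lintegral_of_nonneg_ae (ae_of_all _ h) hm.aestronglyMeasurable

lemma cumHazard_of_nonpos (lam : ℝ → ℝ) {u : ℝ} (hu : u ≤ 0) : cumHazard lam u = 0 := by
  simp [cumHazard, Ioc_eq_empty (not_lt.mpr hu)]

lemma integrableOn_of_lintegral_lt_top {lam : ℝ → ℝ} (hm : Measurable lam) (h : ∀ v, 0 ≤ lam v)
    {u : ℝ} (hu : ∫⁻ v in Ioc (0:ℝ) u, ENNReal.ofReal (lam v) < ⊤) :
    IntegrableOn lam (Ioc 0 u) := by
  refine ⟨hm.aestronglyMeasurable, ?_⟩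
  rw [hasFiniteIntegral_iff_ofReal (ae_of_all _ h)]
  exact hu

lemma continuousOn_cumHazard {lam : ℝ → ℝ} {u : ℝ} (hi : IntegrableOn lam (Ioc 0 u)) :
    ContinuousOn (cumHazard lam) (Icc 0 u) := by
  refine intervalIntegral.continuousOn_primitive ?_
  exact (integrableOn_Icc_iff_integrableOn_Ioc).mpr hi

lemma abs_exp_neg_sub_exp_neg_le {a b : ℝ} (ha : 0 ≤ a) (hb : 0 ≤ b) :
    |Real.exp (-a) - Real.exp (-b)| ≤ |a - b| := by
  wlog hab : a ≤ b generalizing a b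
  · rw [abs_sub_comm, abs_sub_comm a b]
    exact this hb ha (le_of_not_ge hab)
  rw [abs_of_nonneg (sub_nonneg.mpr (Real.exp_le_exp.mpr (by linarith))), abs_sub_comm,
    abs_of_nonneg (by linarith)]
  have h1 : Real.exp (-b) = Real.exp (-a) * Real.exp (-(b - a)) := by
    rw [← Real.exp_add]; ring_nf
  have h2 := Real.add_one_le_exp (-(b - a))
  have h3 : Real.exp (-a) ≤ 1 := Real.exp_le_one_iff.mpr (by linarith)
  rw [h1]
  nlinarith [Real.exp_pos (-a)]

namespace IsHazard

variable {lam : ℝ → ℝ} (hl : IsHazard lam)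
include hl

lemma integrableOn (u : ℝ) : IntegrableOn lam (Ioc 0 u) :=
  integrableOn_of_lintegral_lt_top hl.measurable hl.nonneg (hl.lintegral_lt_top u)

lemma monotone_cumHazard : Monotone (cumHazard lam) := fun _ b hab =>
  setIntegral_mono_set (hl.integrableOn b) (ae_of_all _ hl.nonneg)
    (Ioc_subset_Ioc_right hab).eventuallyLE

lemma exists_le_cumHazard (e : ℝ) : ∃ u, 0 < u ∧ e ≤ cumHazard lam u := by
  by_contra! hcon
  have hU : (⋃ n : ℕ, Ioc (0:ℝ) (n + 1)) = Ioi 0 := by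
    ext x
    simp only [mem_iUnion, mem_Ioc, mem_Ioi]
    refine ⟨fun ⟨_, h⟩ => h.1, fun h => ?_⟩
    obtain ⟨n, hn⟩ := exists_nat_ge x
    exact ⟨n, h, by linarith⟩
  have h1 := hl.lintegral_eq_top
  rw [← hU, setLIntegral_iUnion_of_directed] at h1
  · have h2 : (⨆ n : ℕ, ∫⁻ v in Ioc (0:ℝ) (n + 1), ENNReal.ofReal (lam v))
        ≤ ENNReal.ofReal e := by
      refine iSup_le fun n => ?_
      have h3 := hcon (n + 1) (by positivity)
      rw [cumHazard_eq_toReal hl.measurable hl.nonneg] at h3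
      rw [← ENNReal.ofReal_toReal (hl.lintegral_lt_top _).ne]
      exact ENNReal.ofReal_le_ofReal h3.le
    rw [h1] at h2
    exact ENNReal.ofReal_ne_top (top_le_iff.mp h2)
  · refine Monotone.directed_le fun (_ b : ℕ) hab => Ioc_subset_Ioc_right ?_
    simpa using hab

lemma hitTime_le_iff {a : ℝ} (ha : 0 ≤ a) (e : ℝ) : hitTime lam e ≤ a ↔ e ≤ cumHazard lam a := by
  have hbdd : BddBelow {u : ℝ | 0 < u ∧ e ≤ cumHazard lam u} := ⟨0, fun _ hu => hu.1.le⟩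
  constructor
  · intro h
    have hcont : ContinuousWithinAt (cumHazard lam) (Ioi a) a := by
      have h1 := continuousOn_cumHazard (hl.integrableOn (a + 1)) a ⟨ha, by linarith⟩
      refine h1.mono_of_mem_nhdsWithin ?_
      filter_upwards [Ioo_mem_nhdsGT (show a < a + 1 by linarith)] with x hx
      exact ⟨ha.trans hx.1.le, hx.2.le⟩
    refine ge_of_tendsto hcont ?_
    filter_upwards [self_mem_nhdsWithin] with v hv
    obtain ⟨u, hu, huv⟩ := exists_lt_of_csInf_lt (hl.exists_le_cumHazard e) (h.trans_lt hv)
    exact hu.2.trans (hl.monotone_cumHazard huv.le)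
  · intro h
    rcases ha.eq_or_lt with rfl | ha
    · refine le_of_forall_pos_le_add fun ε hε => csInf_le hbdd ⟨by linarith, ?_⟩
      exact h.trans (hl.monotone_cumHazard (by linarith))
    · exact csInf_le hbdd ⟨ha, h⟩

lemma integral_hazardDensity {u : ℝ} (hu : 0 ≤ u) :
    ∫ v in Ioc (0:ℝ) u, hazardDensity lam v = 1 - Real.exp (-cumHazard lam u) := by
  have hint : IntervalIntegrable lam volume 0 u :=
    (intervalIntegrable_iff_integrableOn_Ioc_of_le hu).mpr (hl.integrableOn u)
  have hΛ : ∀ x ∈ uIcc 0 u, cumHazard lam x = ∫ v in (0:ℝ)..x, lam v := by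
    intro x hx
    rw [uIcc_of_le hu] at hx
    exact (intervalIntegral.integral_of_le hx.1).symm
  have hac : AbsolutelyContinuousOnInterval (fun x => Real.exp (-∫ v in (0:ℝ)..x, lam v)) 0 u := by
    have h := hint.absolutelyContinuousOnInterval_intervalIntegral (c := 0) (by simp)
    rw [absolutelyContinuousOnInterval_iff] at h ⊢
    intro ε hε
    obtain ⟨δ, hδ, h⟩ := h ε hε
    refine ⟨δ, hδ, fun E hE hE' => (Finset.sum_le_sum fun i hi => ?_).trans_lt (h E hE hE')⟩
    obtain ⟨h1, h2⟩ := hE.1 i hi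
    simp only [Real.dist_eq]
    rw [← hΛ _ h1, ← hΛ _ h2]
    exact abs_exp_neg_sub_exp_neg_le (cumHazard_nonneg hl.nonneg _) (cumHazard_nonneg hl.nonneg _)
  have h1 := hac.integral_deriv_eq_sub
  rw [← intervalIntegral.integral_of_le hu]
  have h2 : ∫ v in (0:ℝ)..u, hazardDensity lam v
      = -∫ v in (0:ℝ)..u, deriv (fun x => Real.exp (-∫ v in (0:ℝ)..x, lam v)) v := by
    rw [← intervalIntegral.integral_neg]
    refine intervalIntegral.integral_congr_ae ?_
    filter_upwards [hint.ae_hasDerivAt_integral] with x hx hxu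
    have hx' := uIoc_subset_uIcc hxu
    have hd : HasDerivAt (fun x => Real.exp (-∫ v in (0:ℝ)..x, lam v)) _ x :=
      (hx hx' 0 (by simp)).neg.exp
    rw [hd.deriv, hazardDensity, hΛ x hx']
    simp
  rw [h2, h1, hΛ u (by simp)]
  simp

lemma integrableOn_hazardDensity (u : ℝ) : IntegrableOn (hazardDensity lam) (Ioc 0 u) := by
  refine (hl.integrableOn u).mono' ?_ (ae_of_all _ fun x => ?_)
  · exact ((hl.monotone_cumHazard.measurable.neg.exp).mul hl.measurable).aestronglyMeasurable
  · rw [Real.norm_of_nonneg (hazardDensity_nonneg hl.nonneg x), hazardDensity]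
    exact mul_le_of_le_one_left (hl.nonneg x)
      (Real.exp_le_one_iff.mpr (neg_nonpos.mpr (cumHazard_nonneg hl.nonneg x)))

lemma setLIntegral_Ioc_hazardDensity {u : ℝ} (hu : 0 ≤ u) :
    ∫⁻ v in Ioc (0:ℝ) u, ENNReal.ofReal (hazardDensity lam v)
      = ENNReal.ofReal (1 - Real.exp (-cumHazard lam u)) := by
  rw [← hl.integral_hazardDensity hu, ofReal_integral_eq_lintegral_ofReal
    (hl.integrableOn_hazardDensity u) (ae_of_all _ (hazardDensity_nonneg hl.nonneg))]

/-- The law of the default time of a unit exponential trigger has density `hazardDensity`. -/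
lemma map_hitTime {Ω' : Type*} [MeasurableSpace Ω'] (μ : Measure Ω') [IsProbabilityMeasure μ]
    {E : Ω' → ℝ} (hE : Measurable E)
    (hexp : ∀ x : ℝ, 0 ≤ x → μ {y | x < E y} = ENNReal.ofReal (Real.exp (-x)))
    (hmeas : Measurable (hitTime lam)) :
    μ.map (fun y => hitTime lam (E y))
      = (volume.restrict (Ioi 0)).withDensity fun x => ENNReal.ofReal (hazardDensity lam x) := by
  have hmE : Measurable fun y => hitTime lam (E y) := hmeas.comp hE
  refine Measure.ext_of_Iic _ _ fun a => ?_
  rw [Measure.map_apply hmE measurableSet_Iic, withDensity_apply _ measurableSet_Iic,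
    Measure.restrict_restrict measurableSet_Iic, Iic_inter_Ioi]
  rcases lt_or_ge a 0 with ha | ha
  · rw [Ioc_eq_empty (not_lt.mpr ha.le)]
    simp only [Measure.restrict_empty, lintegral_zero_measure]
    convert measure_empty (μ := μ)
    ext y
    simpa using ha.trans_le (hitTime_nonneg lam (E y))
  · rw [hl.setLIntegral_Ioc_hazardDensity ha]
    have h1 : (fun y => hitTime lam (E y)) ⁻¹' Iic a = {y | cumHazard lam a < E y}ᶜ := by
      ext y
      simp [hl.hitTime_le_iff ha]
    rw [h1, prob_compl_eq_one_sub (measurableSet_lt measurable_const hE),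
      hexp _ (cumHazard_nonneg hl.nonneg a), ENNReal.ofReal_sub _ (Real.exp_pos _).le,
      ENNReal.ofReal_one]

end IsHazard

/-! ### Joint measurability -/

section Measurability

variable {Ω : Type*} [MeasurableSpace Ω] {lam : ℝ → Ω → ℝ}

lemma measurable_lintegral_Ioc (hm : Measurable fun q : ℝ × Ω => lam q.1 q.2) :
    Measurable fun q : ℝ × Ω => ∫⁻ v in Ioc (0:ℝ) q.1, ENNReal.ofReal (lam v q.2) := by
  simp_rw [← lintegral_indicator measurableSet_Ioc]
  have h : Measurable fun r : (ℝ × Ω) × ℝ =>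
      (Ioc (0:ℝ) r.1.1).indicator (fun v => ENNReal.ofReal (lam v r.1.2)) r.2 := by
    have hs : MeasurableSet {r : (ℝ × Ω) × ℝ | 0 < r.2 ∧ r.2 ≤ r.1.1} :=
      (measurableSet_lt measurable_const measurable_snd).inter
        (measurableSet_le measurable_snd (measurable_fst.comp measurable_fst))
    have hf : Measurable fun r : (ℝ × Ω) × ℝ => ENNReal.ofReal (lam r.2 r.1.2) :=
      (hm.comp (measurable_snd.prodMk (measurable_snd.comp measurable_fst))).ennreal_ofReal
    exact hf.indicator hs
  exact h.lintegral_prod_right'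

lemma measurable_cumHazard (hm : Measurable fun q : ℝ × Ω => lam q.1 q.2)
    (h : ∀ v ω, 0 ≤ lam v ω) :
    Measurable fun q : ℝ × Ω => cumHazard (fun v => lam v q.2) q.1 := by
  have h1 := (measurable_lintegral_Ioc hm).ennreal_toReal
  convert h1 using 2 with q
  exact cumHazard_eq_toReal (hm.comp measurable_prodMk_right) (fun v => h v q.2) q.1

lemma measurable_hazardDensity (hm : Measurable fun q : ℝ × Ω => lam q.1 q.2)
    (h : ∀ v ω, 0 ≤ lam v ω) :
    Measurable fun q : ℝ × Ω => hazardDensity (fun v => lam v q.2) q.1 :=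
  (measurable_cumHazard hm h).neg.exp.mul hm

end Measurability

/-- A rational infimum describing the first time at which the (extended-real valued) integrated
hazard rate reaches the level `e`. -/
noncomputable def ratHitTime (lam : ℝ → ℝ) (e : ℝ) : ℝ≥0∞ :=
  ⨅ q : ℚ, if ENNReal.ofReal e ≤ ∫⁻ v in Ioc (0:ℝ) q, ENNReal.ofReal (lam v)
    then ENNReal.ofReal q else ⊤

lemma hitTime_of_nonpos {lam : ℝ → ℝ} (h : ∀ v, 0 ≤ lam v) {e : ℝ} (he : e ≤ 0) :
    hitTime lam e = 0 := by
  have : {u : ℝ | 0 < u ∧ e ≤ cumHazard lam u} = Ioi 0 := by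
    ext u
    simpa using fun _ => he.trans (cumHazard_nonneg h u)
  rw [hitTime, this, csInf_Ioi]

lemma lintegral_Ioc_lt_top_of_pos {lam : ℝ → ℝ} (hm : Measurable lam) (h : ∀ v, 0 ≤ lam v) {u : ℝ}
    (hu : 0 < cumHazard lam u) : ∫⁻ v in Ioc (0:ℝ) u, ENNReal.ofReal (lam v) < ⊤ := by
  rw [cumHazard_eq_toReal hm h] at hu
  exact (ENNReal.toReal_pos_iff.mp hu).2

lemma hitTime_eq_ite {lam : ℝ → ℝ} (hm : Measurable lam) (h : ∀ v, 0 ≤ lam v) {e : ℝ}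
    (he : 0 < e) :
    hitTime lam e = if e ≤ cumHazard lam (ratHitTime lam e).toReal
      then (ratHitTime lam e).toReal else 0 := by
  set T := ratHitTime lam e with hT
  have hpos : ∀ u, e ≤ cumHazard lam u → 0 < u := by
    intro u hu
    by_contra! hcon
    rw [cumHazard_of_nonpos lam hcon] at hu
    linarith
  have hfin := fun u (hu : e ≤ cumHazard lam u) =>
    lintegral_Ioc_lt_top_of_pos hm h (he.trans_le hu)
  have hle : ∀ u, e ≤ cumHazard lam u → T ≤ ENNReal.ofReal u := by
    intro u hu
    refine le_of_forall_gt fun c hc => ?_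
    obtain ⟨q, hq0, hq, hqc⟩ := ENNReal.lt_iff_exists_rat_btwn.mp hc
    have hq' : ENNReal.ofReal (q:ℝ) = (Real.toNNReal q : ℝ≥0∞) := rfl
    rw [← hq'] at hq hqc
    refine lt_of_le_of_lt (iInf_le _ q) ?_
    have huq : u ≤ (q:ℝ) := ((ENNReal.ofReal_lt_ofReal_iff_of_nonneg (hpos u hu).le).mp hq).le
    rw [if_pos]
    · exact hqc
    · rw [cumHazard_eq_toReal hm h] at hu
      exact (ENNReal.ofReal_le_of_le_toReal hu).trans
        (lintegral_mono_set (Ioc_subset_Ioc_right huq))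
  have hbdd : BddBelow {u : ℝ | 0 < u ∧ e ≤ cumHazard lam u} := ⟨0, fun _ hu => hu.1.le⟩
  by_cases hne : ∃ u, e ≤ cumHazard lam u
  · obtain ⟨u, hu⟩ := hne
    have hu0 := hpos u hu
    have hTtop : T ≠ ⊤ := ((hle u hu).trans_lt ENNReal.ofReal_lt_top).ne
    have hTu : T.toReal ≤ u := by
      simpa [ENNReal.toReal_ofReal hu0.le] using ENNReal.toReal_mono ENNReal.ofReal_ne_top (hle u hu)
    have hmem : e ≤ cumHazard lam T.toReal := by
      rcases hTu.eq_or_lt with h1 | hlt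
      · rwa [h1]
      have hcont : ContinuousWithinAt (cumHazard lam) (Ioo T.toReal u) T.toReal :=
        (continuousOn_cumHazard (integrableOn_of_lintegral_lt_top hm h (hfin u hu)) _
          ⟨ENNReal.toReal_nonneg, hTu⟩).mono
          fun x hx => ⟨ENNReal.toReal_nonneg.trans hx.1.le, hx.2.le⟩
      have : (𝓝[Ioo T.toReal u] T.toReal).NeBot := by
        rw [nhdsWithin_Ioo_eq_nhdsGT hlt]; infer_instance
      refine ge_of_tendsto hcont ?_
      filter_upwards [self_mem_nhdsWithin] with x hx
      have hTx : T < ENNReal.ofReal x := (ENNReal.lt_ofReal_iff_toReal_lt hTtop).mpr hx.1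
      rw [hT, ratHitTime, iInf_lt_iff] at hTx
      obtain ⟨q, hq⟩ := hTx
      split_ifs at hq with hq1
      · have hqx : (q:ℝ) ≤ x := by
          by_contra! hcon
          exact absurd (ENNReal.ofReal_le_ofReal hcon.le) (not_le.mpr hq)
        rw [cumHazard_eq_toReal hm h, ← ENNReal.ofReal_le_iff_le_toReal]
        · exact hq1.trans (lintegral_mono_set (Ioc_subset_Ioc_right hqx))
        · exact ((lintegral_mono_set (Ioc_subset_Ioc_right hx.2.le)).trans_lt (hfin u hu)).ne
      · exact absurd hq (by simp)
    rw [if_pos hmem]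
    refine le_antisymm (csInf_le hbdd ⟨hpos _ hmem, hmem⟩) (le_csInf ⟨_, hpos _ hmem, hmem⟩ ?_)
    intro v hv
    simpa [ENNReal.toReal_ofReal hv.1.le] using
      ENNReal.toReal_mono ENNReal.ofReal_ne_top (hle v hv.2)
  · rw [if_neg fun h1 => hne ⟨_, h1⟩]
    have : {u : ℝ | 0 < u ∧ e ≤ cumHazard lam u} = ∅ := by
      ext u
      simpa using fun _ => not_le.mp fun h1 => hne ⟨u, h1⟩
    rw [hitTime, this, Real.sInf_empty]

lemma measurable_hitTime {Ω : Type*} [MeasurableSpace Ω] {lam : ℝ → Ω → ℝ}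
    (hm : Measurable fun q : ℝ × Ω => lam q.1 q.2) (h : ∀ v ω, 0 ≤ lam v ω) :
    Measurable fun q : ℝ × Ω => hitTime (fun v => lam v q.2) q.1 := by
  have hrat : Measurable fun q : ℝ × Ω => ratHitTime (fun v => lam v q.2) q.1 := by
    refine Measurable.iInf fun r => Measurable.ite ?_ measurable_const measurable_const
    exact measurableSet_le measurable_fst.ennreal_ofReal
      ((measurable_lintegral_Ioc hm).comp (measurable_const.prodMk measurable_snd))
  have hcum : Measurable fun q : ℝ × Ω =>
      cumHazard (fun v => lam v q.2) (ratHitTime (fun v => lam v q.2) q.1).toReal :=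
    (measurable_cumHazard hm h).comp (hrat.ennreal_toReal.prodMk measurable_snd)
  have hsec : ∀ ω, Measurable fun v => lam v ω := fun ω => hm.comp measurable_prodMk_right
  have key : (fun q : ℝ × Ω => hitTime (fun v => lam v q.2) q.1) = fun q =>
      if q.1 ≤ 0 then 0 else
        if q.1 ≤ cumHazard (fun v => lam v q.2) (ratHitTime (fun v => lam v q.2) q.1).toReal
        then (ratHitTime (fun v => lam v q.2) q.1).toReal else 0 := by
    ext q
    split_ifs with h1 h2
    · exact hitTime_of_nonpos (fun v => h v q.2) h1
    · rw [hitTime_eq_ite (hsec q.2) (fun v => h v q.2) (not_le.mp h1),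
        if_pos h2]
    · rw [hitTime_eq_ite (hsec q.2) (fun v => h v q.2) (not_le.mp h1),
        if_neg h2]
  rw [key]
  refine Measurable.ite (measurableSet_le measurable_fst measurable_const) measurable_const ?_
  exact Measurable.ite (measurableSet_le measurable_fst hcum) hrat.ennreal_toReal measurable_const

/-! ### Conditional expectation and measurability on products -/

section CondExp

variable {Ω : Type*} {m mΩ : MeasurableSpace Ω} {P : Measure Ω}

lemma lintegral_mul_condLExp (hm : m ≤ mΩ) [IsFiniteMeasure P] {k X : Ω → ℝ≥0∞}
    (hk : AEStronglyMeasurable[m] k P) (hX : AEMeasurable X P) :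
    ∫⁻ ω, k ω * P⁻[X|m] ω ∂P = ∫⁻ ω, k ω * X ω ∂P := by
  obtain ⟨k', hk', hkk'⟩ := hk
  have h1 : ∀ Y : Ω → ℝ≥0∞, AEMeasurable Y P →
      ∫⁻ ω, k ω * Y ω ∂P = ∫⁻ ω, k' ω ∂((P.withDensity Y).trim hm) := by
    intro Y hY
    rw [lintegral_trim hm hk'.measurable, lintegral_withDensity_eq_lintegral_mul₀ hY
      (hk'.measurable.mono hm le_rfl).aemeasurable]
    refine lintegral_congr_ae ?_
    filter_upwards [hkk'] with ω hω
    simp [hω, mul_comm]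
  rw [h1 _ (measurable_condLExp' m P X).aemeasurable, h1 X hX]
  congr 1
  refine @Measure.ext Ω m _ _ fun s hs => ?_
  rw [trim_measurableSet_eq hm hs, trim_measurableSet_eq hm hs, withDensity_apply _ (hm s hs),
    withDensity_apply _ (hm s hs), setLIntegral_condLExp hm P X hs]

lemma lintegral_mul_ofReal_condExp (hm : m ≤ mΩ) [IsFiniteMeasure P] {k : Ω → ℝ≥0∞} {X : Ω → ℝ}
    (hk : AEStronglyMeasurable[m] k P) (hX : Integrable X P) (hX0 : 0 ≤ᵐ[P] X) :
    ∫⁻ ω, k ω * ENNReal.ofReal (P[X|m] ω) ∂P = ∫⁻ ω, k ω * ENNReal.ofReal (X ω) ∂P := by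
  rw [← lintegral_mul_condLExp hm hk hX.1.aemeasurable.ennreal_ofReal]
  refine lintegral_congr_ae ?_
  filter_upwards [condLExp_ofReal m hX hX0] with ω hω
  rw [hω]

variable {α : Type*} [mα : MeasurableSpace α] {ν : Measure α}

/-- A jointly measurable bounded function all of whose sections are (almost everywhere)
measurable with respect to a sub-σ-algebra is itself almost everywhere measurable with respect to
the product of the sub-σ-algebras. -/
lemma aestronglyMeasurable_prod_of_sections_of_le_one (hm : m ≤ mΩ) [IsFiniteMeasure ν]
    [IsFiniteMeasure P] {h : α × Ω → ℝ≥0∞} (hh : Measurable h) (hb : ∀ q, h q ≤ 1)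
    (hsec : ∀ᵐ y ∂ν, AEStronglyMeasurable[m] (fun ω => h (y, ω)) P) :
    AEStronglyMeasurable[mα.prod m] h (ν.prod P) := by
  have hmp : mα.prod m ≤ mα.prod mΩ := sup_le_sup le_rfl (MeasurableSpace.comap_mono hm)
  set H := (ν.prod P)⁻[h|mα.prod m] with hH
  have hHm : Measurable[mα.prod m] H := measurable_condLExp _ _ _
  have hHm' : Measurable H := measurable_condLExp' _ _ _
  have hHsec : ∀ y, Measurable[m] fun ω => H (y, ω) := fun y =>
    hHm.comp (@measurable_prodMk_left α Ω mα m y)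
  have hint : ∫⁻ q, h q ∂(ν.prod P) ≠ ⊤ := by
    refine ((lintegral_mono hb).trans_lt ?_).ne
    simp [lt_top_iff_ne_top]
  have hrect : ∀ {K : α × Ω → ℝ≥0∞}, Measurable K →
      (∀ᵐ y ∂ν, AEStronglyMeasurable[m] (fun ω => K (y, ω)) P) →
      ∀ {s : Set α} {t : Set Ω}, MeasurableSet s → MeasurableSet t →
      ∫⁻ q in s ×ˢ t, K q ∂(ν.prod P)
        = ∫⁻ q, (s.indicator 1 q.1 * P⁻[t.indicator 1|m] q.2) * K q ∂(ν.prod P) := by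
    intro K hK hKsec s t hs ht
    have h1 : Measurable fun q : α × Ω => s.indicator (1 : α → ℝ≥0∞) q.1 :=
      (measurable_one.indicator hs).comp measurable_fst
    have h2 : Measurable fun q : α × Ω => t.indicator (1 : Ω → ℝ≥0∞) q.2 :=
      (measurable_one.indicator ht).comp measurable_snd
    have h3 : Measurable fun q : α × Ω => P⁻[t.indicator 1|m] q.2 :=
      (measurable_condLExp' m P _).comp measurable_snd
    rw [← lintegral_indicator (hs.prod ht)]
    have h4 : (fun q => (s ×ˢ t).indicator K q)
        = fun q => (s.indicator 1 q.1 * t.indicator 1 q.2) * K q := by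
      ext ⟨a, b⟩
      by_cases ha : a ∈ s <;> by_cases hb : b ∈ t <;> simp [ha, hb]
    have hm2 : Measurable fun q => (s.indicator 1 q.1 * t.indicator 1 q.2) * K q :=
      (h1.mul h2).mul hK
    have hm3 : Measurable fun q => (s.indicator 1 q.1 * P⁻[t.indicator 1|m] q.2) * K q :=
      (h1.mul h3).mul hK
    rw [h4, lintegral_prod _ hm2.aemeasurable, lintegral_prod _ hm3.aemeasurable]
    refine lintegral_congr_ae ?_
    filter_upwards [hKsec] with y hy
    have h5 := lintegral_mul_condLExp hm hy
      (measurable_one.indicator ht : Measurable (t.indicator (1 : Ω → ℝ≥0∞))).aemeasurable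
    have hKy : Measurable fun ω => K (y, ω) := hK.comp measurable_prodMk_left
    have hm4 : Measurable fun ω => t.indicator 1 ω * K (y, ω) :=
      (measurable_one.indicator ht).mul hKy
    have hm5 : Measurable fun ω => P⁻[t.indicator 1|m] ω * K (y, ω) :=
      (measurable_condLExp' m P _).mul hKy
    simp only [mul_assoc]
    rw [lintegral_const_mul _ hm4, lintegral_const_mul _ hm5]
    simp only [mul_comm _ (K (y, _))]
    rw [h5]
  have hfin : IsFiniteMeasure ((ν.prod P).withDensity h) := isFiniteMeasure_withDensity hint
  have hmeas : (ν.prod P).withDensity h = (ν.prod P).withDensity H := by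
    refine Measure.ext_prod fun {s t} hs ht => ?_
    rw [withDensity_apply _ (hs.prod ht), withDensity_apply _ (hs.prod ht), hrect hh hsec hs ht,
      hrect hHm' (ae_of_all _ fun y => (hHsec y).stronglyMeasurable.aestronglyMeasurable) hs ht]
    refine (lintegral_mul_condLExp hmp ?_ hh.aemeasurable).symm
    refine Measurable.aestronglyMeasurable ?_
    refine Measurable.mul ?_ ?_
    · exact (measurable_one.indicator hs).comp (@measurable_fst α Ω mα m)
    · exact (measurable_condLExp m P _).comp (@measurable_snd α Ω mα m)
  have hae : h =ᵐ[ν.prod P] H :=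
    (withDensity_eq_iff hh.aemeasurable hHm'.aemeasurable hint).mp hmeas
  exact ⟨H, hHm.stronglyMeasurable, hae⟩

lemma aestronglyMeasurable_prod_of_sections (hm : m ≤ mΩ) [IsFiniteMeasure ν]
    [IsFiniteMeasure P] {h : α × Ω → ℝ} (hh : Measurable h)
    (hsec : ∀ᵐ y ∂ν, AEStronglyMeasurable[m] (fun ω => h (y, ω)) P) :
    AEStronglyMeasurable[mα.prod m] h (ν.prod P) := by
  have hcont : Continuous fun x : ℝ => ENNReal.ofReal ((Real.arctan x + 2) / 4) :=
    ENNReal.continuous_ofReal.comp (by fun_prop)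
  obtain ⟨k, hk, hhk⟩ := aestronglyMeasurable_prod_of_sections_of_le_one (ν := ν) (P := P) hm
    (h := fun q => ENNReal.ofReal ((Real.arctan (h q) + 2) / 4)) (hcont.measurable.comp hh)
    (fun q => by
      rw [← ENNReal.ofReal_one]
      refine ENNReal.ofReal_le_ofReal ?_
      linarith [Real.arctan_lt_pi_div_two (h q), Real.pi_lt_four])
    (hsec.mono fun y hy => hcont.comp_aestronglyMeasurable hy)
  have hmeas : Measurable fun x : ℝ≥0∞ => Real.tan (x.toReal * 4 - 2) := by
    have h1 : (fun x : ℝ≥0∞ => Real.tan (x.toReal * 4 - 2))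
        = fun x => Real.sin (x.toReal * 4 - 2) / Real.cos (x.toReal * 4 - 2) := by
      ext x; exact Real.tan_eq_sin_div_cos _
    rw [h1]
    fun_prop
  refine ⟨fun q => Real.tan ((k q).toReal * 4 - 2),
    (hmeas.comp hk.measurable).stronglyMeasurable, ?_⟩
  filter_upwards [hhk] with q hq
  rw [← hq, ENNReal.toReal_ofReal]
  · rw [show (Real.arctan (h q) + 2) / 4 * 4 - 2 = Real.arctan (h q) by ring, Real.tan_arctan]
  · linarith [Real.neg_pi_div_two_lt_arctan (h q), Real.pi_lt_four]

lemma aestronglyMeasurable_integral_of_sections (hm : m ≤ mΩ) [IsFiniteMeasure ν]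
    [IsFiniteMeasure P] {h : α × Ω → ℝ} (hh : Measurable h)
    (hsec : ∀ᵐ y ∂ν, AEStronglyMeasurable[m] (fun ω => h (y, ω)) P) :
    AEStronglyMeasurable[m] (fun ω => ∫ y, h (y, ω) ∂ν) P := by
  obtain ⟨k, hk, hhk⟩ := aestronglyMeasurable_prod_of_sections hm hh hsec
  refine ⟨fun ω => ∫ y, k (y, ω) ∂ν,
    @StronglyMeasurable.integral_prod_left' α Ω ℝ mα m ν _ _ _ k hk, ?_⟩
  have h1 : ∀ᵐ q ∂(P.prod ν), h q.swap = k q.swap :=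
    Measure.measurePreserving_swap.quasiMeasurePreserving.ae hhk
  filter_upwards [Measure.ae_ae_of_ae_prod h1] with ω hω
  exact integral_congr_ae hω

end CondExp

lemma aestronglyMeasurable_cumHazard {Ω : Type*} {mΩ : MeasurableSpace Ω} {P : Measure Ω}
    [IsFiniteMeasure P] {F : Filtration ℝ mΩ} {lam : ℝ → Ω → ℝ}
    (hm : Measurable fun q : ℝ × Ω => lam q.1 q.2)
    (hadapted : ∀ t, Measurable[F t] fun ω => lam t ω) {r t : ℝ} (hrt : r ≤ t) :
    AEStronglyMeasurable[F t] (fun ω => cumHazard (fun v => lam v ω) r) P := by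
  refine aestronglyMeasurable_integral_of_sections (F.le t) hm ?_
  filter_upwards [ae_restrict_mem measurableSet_Ioc] with y hy
  exact ((hadapted y).mono (F.mono (hy.2.trans hrt)) le_rfl).aestronglyMeasurable

/-! ### Integrals against hazard densities -/

lemma measurable_setIntegral_Ioc {β : Type*} [MeasurableSpace β] {k : β × ℝ → ℝ}
    (hk : Measurable k) {a b : β → ℝ} (ha : Measurable a) (hb : Measurable b) :
    Measurable fun y => ∫ x in Ioc (a y) (b y), k (y, x) := by
  simp_rw [← integral_indicator measurableSet_Ioc]
  have h : Measurable fun q : β × ℝ => (Ioc (a q.1) (b q.1)).indicator (fun x => k (q.1, x)) q.2 := by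
    have hs : MeasurableSet {q : β × ℝ | a q.1 < q.2 ∧ q.2 ≤ b q.1} :=
      (measurableSet_lt (ha.comp measurable_fst) measurable_snd).inter
        (measurableSet_le measurable_snd (hb.comp measurable_fst))
    exact hk.indicator hs
  exact h.stronglyMeasurable.integral_prod_right'.measurable

namespace IsHazard

variable {lam : ℝ → ℝ} (hl : IsHazard lam)
include hl

lemma measurable_hazardDensity : Measurable (hazardDensity lam) :=
  (hl.monotone_cumHazard.measurable.neg.exp).mul hl.measurable

lemma tendsto_cumHazard : Filter.Tendsto (cumHazard lam) Filter.atTop Filter.atTop :=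
  Filter.tendsto_atTop_atTop_of_monotone hl.monotone_cumHazard fun e =>
    (hl.exists_le_cumHazard e).imp fun _ h => h.2

lemma setLIntegral_Ioi_zero_hazardDensity :
    ∫⁻ v in Ioi (0:ℝ), ENNReal.ofReal (hazardDensity lam v) = 1 := by
  have hcov : AECover (volume.restrict (Ioi (0:ℝ))) Filter.atTop fun b : ℝ => Iic b :=
    aecover_Iic Filter.tendsto_id
  refine hcov.lintegral_eq_of_tendsto _ hl.measurable_hazardDensity.ennreal_ofReal.aemeasurable ?_
  have h1 : Filter.Tendsto (fun b => ENNReal.ofReal (1 - Real.exp (-cumHazard lam b)))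
      Filter.atTop (𝓝 (ENNReal.ofReal (1 - 0))) :=
    ENNReal.tendsto_ofReal (tendsto_const_nhds.sub
      (Real.tendsto_exp_neg_atTop_nhds_zero.comp hl.tendsto_cumHazard))
  rw [sub_zero, ENNReal.ofReal_one] at h1
  refine h1.congr' ?_
  filter_upwards [Filter.eventually_ge_atTop 0] with b hb
  rw [Measure.restrict_restrict measurableSet_Iic, Iic_inter_Ioi,
    hl.setLIntegral_Ioc_hazardDensity hb]

lemma setLIntegral_Ioi_hazardDensity {r : ℝ} (hr : 0 ≤ r) :
    ∫⁻ v in Ioi r, ENNReal.ofReal (hazardDensity lam v)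
      = ENNReal.ofReal (Real.exp (-cumHazard lam r)) := by
  have h1 := hl.setLIntegral_Ioi_zero_hazardDensity
  have h3 : Real.exp (-cumHazard lam r) ≤ 1 :=
    Real.exp_le_one_iff.mpr (neg_nonpos.mpr (cumHazard_nonneg hl.nonneg r))
  rw [← Ioc_union_Ioi_eq_Ioi hr, lintegral_union measurableSet_Ioi Ioc_disjoint_Ioi_same,
    hl.setLIntegral_Ioc_hazardDensity hr] at h1
  have h2 : ENNReal.ofReal (1 - Real.exp (-cumHazard lam r))
      + ENNReal.ofReal (Real.exp (-cumHazard lam r)) = 1 := by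
    rw [← ENNReal.ofReal_add (by linarith) (Real.exp_pos _).le]
    simp
  exact (ENNReal.add_right_inj ENNReal.ofReal_ne_top).mp (h1.trans h2.symm)

variable {W : ℝ → ℝ} (hW : Measurable W) (hW0 : ∀ x, 0 ≤ W x) {C : ℝ} (hWC : ∀ x, W x ≤ C)
include hW hW0 hWC

lemma integrableOn_mul_hazardDensity {a b : ℝ} (ha : 0 ≤ a) :
    IntegrableOn (fun x => W x * hazardDensity lam x) (Ioc a b) := by
  refine (((hl.integrableOn_hazardDensity b).mono_set (Ioc_subset_Ioc_left ha)).const_mul C).mono'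
    (hW.mul hl.measurable_hazardDensity).aestronglyMeasurable (ae_of_all _ fun x => ?_)
  have h := hazardDensity_nonneg hl.nonneg x
  rw [Real.norm_of_nonneg (mul_nonneg (hW0 x) h)]
  exact mul_le_mul_of_nonneg_right (hWC x) h

lemma setLIntegral_Ioc_mul_ofReal {a b : ℝ} (ha : 0 ≤ a) :
    ∫⁻ x in Ioc a b, ENNReal.ofReal (hazardDensity lam x) * ENNReal.ofReal (W x)
      = ENNReal.ofReal (∫ x in Ioc a b, W x * Real.exp (-(∫ w in Ioc (0:ℝ) x, lam w)) * lam x) := by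
  simp_rw [mul_assoc]
  change _ = ENNReal.ofReal (∫ x in Ioc a b, W x * hazardDensity lam x)
  rw [ofReal_integral_eq_lintegral_ofReal (hl.integrableOn_mul_hazardDensity hW hW0 hWC ha)
    (ae_of_all _ fun x => mul_nonneg (hW0 x) (hazardDensity_nonneg hl.nonneg x))]
  refine lintegral_congr fun x => ?_
  rw [← ENNReal.ofReal_mul (hazardDensity_nonneg hl.nonneg x), mul_comm]

lemma setIntegral_Ioc_mul_mem_Icc {a b : ℝ} (ha : 0 ≤ a) :
    ∫ x in Ioc a b, W x * Real.exp (-(∫ w in Ioc (0:ℝ) x, lam w)) * lam x ∈ Icc 0 C := by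
  have hC : 0 ≤ C := (hW0 0).trans (hWC 0)
  have h0 : ∀ x, 0 ≤ W x * hazardDensity lam x := fun x =>
    mul_nonneg (hW0 x) (hazardDensity_nonneg hl.nonneg x)
  simp_rw [mul_assoc]
  refine ⟨integral_nonneg h0, ?_⟩
  rcases lt_or_ge b 0 with hb | hb
  · rw [Ioc_eq_empty (by linarith)]
    simpa using hC
  calc ∫ x in Ioc a b, W x * hazardDensity lam x
      ≤ ∫ x in Ioc 0 b, W x * hazardDensity lam x :=
        setIntegral_mono_set (hl.integrableOn_mul_hazardDensity hW hW0 hWC le_rfl)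
          (ae_of_all _ h0) (Ioc_subset_Ioc_left ha).eventuallyLE
    _ ≤ ∫ x in Ioc 0 b, C * hazardDensity lam x :=
        setIntegral_mono (hl.integrableOn_mul_hazardDensity hW hW0 hWC le_rfl)
          ((hl.integrableOn_hazardDensity b).const_mul C) fun x =>
          mul_le_mul_of_nonneg_right (hWC x) (hazardDensity_nonneg hl.nonneg x)
    _ ≤ C := by
        rw [integral_const_mul, hl.integral_hazardDensity hb]
        nlinarith [Real.exp_pos (-cumHazard lam b)]

end IsHazard

lemma setLIntegral_Ioi_zero_eq_add {t : ℝ} (ht : 0 ≤ t) (f : ℝ → ℝ≥0∞) :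
    ∫⁻ y in Ioi 0, f y = (∫⁻ y in Ioc 0 t, f y) + ∫⁻ y in Ioi t, f y := by
  rw [← Ioc_union_Ioi_eq_Ioi ht, lintegral_union measurableSet_Ioi Ioc_disjoint_Ioi_same]

section TwoDefaults

variable {lam1 lam2 : ℝ → ℝ} (h1 : IsHazard lam1) (h2 : IsHazard lam2)
include h1 h2

/-- The expected payoff at the second default time, given the rates, weighted by a function of the
first default time. -/
lemma lintegral_payoff_eq {Zf : ℝ → ℝ} (hZ : Measurable Zf) (hZ0 : ∀ u, 0 ≤ Zf u) {C : ℝ}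
    (hZC : ∀ u, Zf u ≤ C) {t s : ℝ} (ht : 0 ≤ t) (b : ℝ≥0∞) (c : ℝ → ℝ≥0∞) :
    ∫⁻ y in Ioi (0:ℝ), ENNReal.ofReal (hazardDensity lam1 y) *
        ∫⁻ x in Ioi (0:ℝ), ENNReal.ofReal (hazardDensity lam2 x) *
          ((if t < y then b else c y) * ENNReal.ofReal ((Ioc t s).indicator Zf (y + x)))
      = (∫⁻ y in Ioc (0:ℝ) t, ENNReal.ofReal (hazardDensity lam1 y) *
          (c y * ENNReal.ofReal (∫ x in Ioc (t - y) (s - y),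
            Zf (y + x) * Real.exp (-(∫ w in Ioc (0:ℝ) x, lam2 w)) * lam2 x)))
        + b * ENNReal.ofReal (∫ y in Ioc t s,
            (∫ x in Ioc (0:ℝ) (s - y),
              Zf (y + x) * Real.exp (-(∫ w in Ioc (0:ℝ) x, lam2 w)) * lam2 x)
            * Real.exp (-(∫ w in Ioc (0:ℝ) y, lam1 w)) * lam1 y) := by
  have hZy : ∀ y, Measurable fun x => Zf (y + x) := fun y => hZ.comp (measurable_const_add y)
  have hinner : ∀ (y a : ℝ) (d : ℝ≥0∞), 0 ≤ a → (∀ x, 0 < x → (t < y + x ↔ a < x)) →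
      ∫⁻ x in Ioi (0:ℝ), ENNReal.ofReal (hazardDensity lam2 x) *
          (d * ENNReal.ofReal ((Ioc t s).indicator Zf (y + x)))
        = d * ENNReal.ofReal (∫ x in Ioc a (s - y),
            Zf (y + x) * Real.exp (-(∫ w in Ioc (0:ℝ) x, lam2 w)) * lam2 x) := by
    intro y a d ha hiff
    have hm : Measurable fun x =>
        ENNReal.ofReal (hazardDensity lam2 x) * ENNReal.ofReal (Zf (y + x)) :=
      h2.measurable_hazardDensity.ennreal_ofReal.mul (hZy y).ennreal_ofReal
    rw [← h2.setLIntegral_Ioc_mul_ofReal (hZy y) (fun _ => hZ0 _) (fun _ => hZC _) ha,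
      ← lintegral_const_mul d hm,
      ← lintegral_indicator measurableSet_Ioi, ← lintegral_indicator measurableSet_Ioc]
    refine lintegral_congr fun x => ?_
    by_cases hx : 0 < x
    · by_cases hm : y + x ∈ Ioc t s
      · rw [indicator_of_mem (show x ∈ Ioi 0 from hx), indicator_of_mem hm, indicator_of_mem]
        · ring
        · exact ⟨(hiff x hx).mp hm.1, by linarith [hm.2]⟩
      · rw [indicator_of_mem (show x ∈ Ioi 0 from hx), indicator_of_notMem hm, indicator_of_notMem]
        · simp
        · exact fun h => hm ⟨(hiff x hx).mpr h.1, by linarith [h.2]⟩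
    · rw [indicator_of_notMem (by simpa using hx), indicator_of_notMem]
      exact fun h => hx (ha.trans_lt h.1)
  rw [setLIntegral_Ioi_zero_eq_add ht]
  refine congrArg₂ (· + ·) ?_ ?_
  · refine setLIntegral_congr_fun measurableSet_Ioc fun y hy => ?_
    simp only [if_neg (not_lt.mpr hy.2)]
    rw [hinner y (t - y) _ (by linarith [hy.2])
      (fun x _ => by constructor <;> intro h <;> linarith)]
  · have hV : Measurable fun y => ∫ x in Ioc (0:ℝ) (s - y),
        Zf (y + x) * Real.exp (-(∫ w in Ioc (0:ℝ) x, lam2 w)) * lam2 x := by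
      refine measurable_setIntegral_Ioc (k := fun q : ℝ × ℝ =>
        Zf (q.1 + q.2) * Real.exp (-cumHazard lam2 q.2) * lam2 q.2) ?_ measurable_const
        (measurable_const.sub measurable_id)
      have e1 : Measurable fun q : ℝ × ℝ => Zf (q.1 + q.2) :=
        hZ.comp (measurable_fst.add measurable_snd)
      have e2 : Measurable fun q : ℝ × ℝ => cumHazard lam2 q.2 :=
        h2.monotone_cumHazard.measurable.comp measurable_snd
      have e3 : Measurable fun q : ℝ × ℝ => lam2 q.2 := h2.measurable.comp measurable_snd
      exact (e1.mul e2.neg.exp).mul e3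
    have hmem := fun y => h2.setIntegral_Ioc_mul_mem_Icc (hZy y) (fun _ => hZ0 _) (fun _ => hZC _)
      (le_refl (0:ℝ)) (b := s - y)
    have hm : Measurable fun y => ENNReal.ofReal (hazardDensity lam1 y) * ENNReal.ofReal
        (∫ x in Ioc (0:ℝ) (s - y),
          Zf (y + x) * Real.exp (-(∫ w in Ioc (0:ℝ) x, lam2 w)) * lam2 x) :=
      h1.measurable_hazardDensity.ennreal_ofReal.mul hV.ennreal_ofReal
    rw [← h1.setLIntegral_Ioc_mul_ofReal hV (fun y => (hmem y).1) (fun y => (hmem y).2) ht,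
      ← lintegral_const_mul b hm,
      ← lintegral_indicator measurableSet_Ioi, ← lintegral_indicator measurableSet_Ioc]
    refine lintegral_congr fun y => ?_
    by_cases hy : t < y
    · rw [indicator_of_mem (show y ∈ Ioi t from hy)]
      simp only [if_pos hy]
      rw [hinner y 0 _ le_rfl (fun x hx => by constructor <;> intro h <;> linarith)]
      by_cases hys : y ≤ s
      · rw [indicator_of_mem (show y ∈ Ioc t s from ⟨hy, hys⟩)]
        ring
      · rw [indicator_of_notMem (fun h => hys h.2), Ioc_eq_empty (by linarith)]
        simp
    · rw [indicator_of_notMem (by simpa using hy), indicator_of_notMem (fun h => hy h.1)]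

/-- The expectation, given the rates, of a candidate value at time `t`, weighted by a function of
the first default time. -/
lemma lintegral_value_eq {t : ℝ} (ht : 0 ≤ t) (b : ℝ≥0∞) (c : ℝ → ℝ≥0∞) (G : ℝ → ℝ) (i : ℝ) :
    ∫⁻ y in Ioi (0:ℝ), ENNReal.ofReal (hazardDensity lam1 y) *
        ∫⁻ x in Ioi (0:ℝ), ENNReal.ofReal (hazardDensity lam2 x) *
          ((if t < y then b else c y) * ENNReal.ofReal
            (if t < y then Real.exp (cumHazard lam1 t) * i
              else if t < y + x then Real.exp (cumHazard lam2 (t - y)) * G y else 0))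
      = (∫⁻ y in Ioc (0:ℝ) t, ENNReal.ofReal (hazardDensity lam1 y) * (c y * ENNReal.ofReal (G y)))
        + b * ENNReal.ofReal i := by
  have hexp : ∀ a : ℝ, ENNReal.ofReal (Real.exp (-a)) * ENNReal.ofReal (Real.exp a) = 1 := by
    intro a
    rw [← ENNReal.ofReal_mul (Real.exp_pos _).le, ← Real.exp_add]
    simp
  have hm1 := h1.measurable_hazardDensity.ennreal_ofReal
  have hm2 := h2.measurable_hazardDensity.ennreal_ofReal
  rw [setLIntegral_Ioi_zero_eq_add ht]
  refine congrArg₂ (· + ·) ?_ ?_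
  · refine setLIntegral_congr_fun measurableSet_Ioc fun y hy => ?_
    simp only [if_neg (not_lt.mpr hy.2)]
    congr 1
    have h3 : ∀ x, (Ioi (0:ℝ)).indicator (fun x => ENNReal.ofReal (hazardDensity lam2 x) *
        (c y * ENNReal.ofReal (if t < y + x then Real.exp (cumHazard lam2 (t - y)) * G y else 0))) x
        = (Ioi (t - y)).indicator (fun x => ENNReal.ofReal (hazardDensity lam2 x) *
          (c y * ENNReal.ofReal (Real.exp (cumHazard lam2 (t - y)) * G y))) x := by
      intro x
      by_cases hx : t < y + x
      · rw [indicator_of_mem (show x ∈ Ioi 0 by simp only [mem_Ioi]; linarith [hy.2]),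
          indicator_of_mem (show x ∈ Ioi (t - y) by simp only [mem_Ioi]; linarith), if_pos hx]
      · rw [indicator_of_notMem (s := Ioi (t - y)) (by simp only [mem_Ioi]; linarith)]
        simp [hx, indicator]
    rw [← lintegral_indicator measurableSet_Ioi, lintegral_congr h3,
      lintegral_indicator measurableSet_Ioi, lintegral_mul_const _ hm2,
      h2.setLIntegral_Ioi_hazardDensity (by linarith [hy.2]), ENNReal.ofReal_mul (Real.exp_pos _).le]
    rw [show ∀ p q r z : ℝ≥0∞, p * (q * (r * z)) = (p * r) * (q * z) from fun _ _ _ _ => by ring,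
      hexp, one_mul]
  · have h3 : ∀ y ∈ Ioi t, ENNReal.ofReal (hazardDensity lam1 y) *
        ∫⁻ x in Ioi (0:ℝ), ENNReal.ofReal (hazardDensity lam2 x) *
          ((if t < y then b else c y) * ENNReal.ofReal
            (if t < y then Real.exp (cumHazard lam1 t) * i
              else if t < y + x then Real.exp (cumHazard lam2 (t - y)) * G y else 0))
        = ENNReal.ofReal (hazardDensity lam1 y) *
          (b * ENNReal.ofReal (Real.exp (cumHazard lam1 t) * i)) := by
      intro y hy
      simp only [if_pos (mem_Ioi.mp hy)]
      rw [lintegral_mul_const _ hm2, h2.setLIntegral_Ioi_zero_hazardDensity, one_mul]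
    rw [setLIntegral_congr_fun measurableSet_Ioi h3, lintegral_mul_const _ hm1,
      h1.setLIntegral_Ioi_hazardDensity ht, ENNReal.ofReal_mul (Real.exp_pos _).le]
    rw [show ∀ p q r z : ℝ≥0∞, p * (q * (r * z)) = (p * r) * (q * z) from fun _ _ _ _ => by ring,
      hexp, one_mul]

end TwoDefaults

/-! ### The joint law of the two default times -/

section JointLaw

variable {Ω' : Type*} [MeasurableSpace Ω'] {Phat : Measure Ω'} [IsProbabilityMeasure Phat]
  {E₁ E₂ : Ω' → ℝ} (hE₁ : Measurable E₁) (hE₂ : Measurable E₂) (hEindep : IndepFun E₁ E₂ Phat)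
  (hE₁exp : ∀ x : ℝ, 0 ≤ x → Phat {y | x < E₁ y} = ENNReal.ofReal (Real.exp (-x)))
  (hE₂exp : ∀ x : ℝ, 0 ≤ x → Phat {y | x < E₂ y} = ENNReal.ofReal (Real.exp (-x)))
include hE₁ hE₂ hEindep hE₁exp hE₂exp

lemma IsHazard.lintegral_hitTime_hitTime {lam1 lam2 : ℝ → ℝ} (h1 : IsHazard lam1)
    (h2 : IsHazard lam2) (hm1 : Measurable (hitTime lam1)) (hm2 : Measurable (hitTime lam2))
    {φ : ℝ × ℝ → ℝ≥0∞} (hφ : Measurable φ) :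
    ∫⁻ q, φ (hitTime lam1 (E₁ q), hitTime lam2 (E₂ q)) ∂Phat
      = ∫⁻ y in Ioi (0:ℝ), ENNReal.ofReal (hazardDensity lam1 y) *
          ∫⁻ x in Ioi (0:ℝ), ENNReal.ofReal (hazardDensity lam2 x) * φ (y, x) := by
  have hT1 : Measurable fun q => hitTime lam1 (E₁ q) := hm1.comp hE₁
  have hT2 : Measurable fun q => hitTime lam2 (E₂ q) := hm2.comp hE₂
  have hprod := (indepFun_iff_map_prod_eq_prod_map_map hT1.aemeasurable hT2.aemeasurable).mp
    (hEindep.comp hm1 hm2)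
  rw [← lintegral_map hφ (hT1.prodMk hT2), hprod, lintegral_prod _ hφ.aemeasurable,
    h1.map_hitTime Phat hE₁ hE₁exp hm1, h2.map_hitTime Phat hE₂ hE₂exp hm2]
  have hd1 := h1.measurable_hazardDensity.ennreal_ofReal
  have hd2 := h2.measurable_hazardDensity.ennreal_ofReal
  have hinner : ∀ y, ∫⁻ x, φ (y, x) ∂((volume.restrict (Ioi 0)).withDensity fun x =>
        ENNReal.ofReal (hazardDensity lam2 x))
      = ∫⁻ x in Ioi (0:ℝ), ENNReal.ofReal (hazardDensity lam2 x) * φ (y, x) := fun y =>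
    lintegral_withDensity_eq_lintegral_mul _ hd2 (hφ.comp measurable_prodMk_left)
  simp_rw [hinner]
  refine lintegral_withDensity_eq_lintegral_mul _ hd1 ?_
  exact Measurable.lintegral_prod_right' (f := fun q : ℝ × ℝ =>
    ENNReal.ofReal (hazardDensity lam2 q.2) * φ q) ((hd2.comp measurable_snd).mul hφ)

variable {Ω : Type*} [MeasurableSpace Ω] {P : Measure Ω} {lam1 lam2 : ℝ → Ω → ℝ}
  (hm1 : Measurable fun q : ℝ × Ω => lam1 q.1 q.2) (hm2 : Measurable fun q : ℝ × Ω => lam2 q.1 q.2)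
  (h01 : ∀ v ω, 0 ≤ lam1 v ω) (h02 : ∀ v ω, 0 ≤ lam2 v ω)
  (h1 : ∀ᵐ ω ∂P, IsHazard fun v => lam1 v ω) (h2 : ∀ᵐ ω ∂P, IsHazard fun v => lam2 v ω)
include hm1 hm2 h01 h02 h1 h2

lemma lintegral_hitTime_hitTime {φ : Ω × ℝ × ℝ → ℝ≥0∞} (hφ : Measurable φ) :
    ∫⁻ p, φ (p.1, hitTime (fun v => lam1 v p.1) (E₁ p.2), hitTime (fun v => lam2 v p.1) (E₂ p.2))
        ∂(P.prod Phat)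
      = ∫⁻ ω, (∫⁻ y in Ioi (0:ℝ), ENNReal.ofReal (hazardDensity (fun v => lam1 v ω) y) *
          ∫⁻ x in Ioi (0:ℝ), ENNReal.ofReal (hazardDensity (fun v => lam2 v ω) x) *
            φ (ω, y, x)) ∂P := by
  have hT1 := measurable_hitTime hm1 h01
  have hT2 := measurable_hitTime hm2 h02
  have hT : Measurable fun p : Ω × Ω' => φ (p.1, hitTime (fun v => lam1 v p.1) (E₁ p.2),
      hitTime (fun v => lam2 v p.1) (E₂ p.2)) := by
    refine hφ.comp (measurable_fst.prodMk (Measurable.prodMk ?_ ?_))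
    · exact hT1.comp ((hE₁.comp measurable_snd).prodMk measurable_fst)
    · exact hT2.comp ((hE₂.comp measurable_snd).prodMk measurable_fst)
  rw [lintegral_prod _ hT.aemeasurable]
  refine lintegral_congr_ae ?_
  filter_upwards [h1, h2] with ω hω1 hω2
  exact hω1.lintegral_hitTime_hitTime hE₁ hE₂ hEindep hE₁exp hE₂exp hω2
    (hT1.comp measurable_prodMk_right) (hT2.comp measurable_prodMk_right)
    (hφ.comp measurable_prodMk_left)

/-- A property of the path and of the first default time holding almost everywhere for the product
with Lebesgue measure on `(0, t]` holds almost surely before `t`. -/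
lemma ae_of_ae_prod_of_hitTime_le {t : ℝ} {p : ℝ × Ω → Prop} [SFinite P]
    (hp : ∀ᵐ q ∂((volume.restrict (Ioc 0 t)).prod P), p q) :
    ∀ᵐ q ∂(P.prod Phat), hitTime (fun v => lam1 v q.1) (E₁ q.2) ≤ t →
      p (hitTime (fun v => lam1 v q.1) (E₁ q.2), q.1) := by
  set μ := (volume.restrict (Ioc 0 t)).prod P with hμ
  set N := toMeasurable μ {q | ¬ p q} with hN
  have hN0 : μ N = 0 := by rw [hN, measure_toMeasurable]; exact hp
  have hNm : MeasurableSet N := measurableSet_toMeasurable _ _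
  set N' : Set (Ω × ℝ × ℝ) := {q | q.2.1 ≤ t ∧ (q.2.1, q.1) ∈ N} with hN'
  have hN'm : MeasurableSet N' :=
    (measurableSet_le measurable_snd.fst measurable_const).inter
      ((measurable_snd.fst.prodMk measurable_fst) hNm)
  have hlaw := lintegral_hitTime_hitTime hE₁ hE₂ hEindep hE₁exp hE₂exp hm1 hm2 h01 h02 h1 h2
    (φ := N'.indicator 1) (measurable_one.indicator hN'm)
  have hzero : ∀ᵐ ω ∂P, ∀ᵐ y ∂(volume.restrict (Ioc 0 t)), (y, ω) ∉ N := by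
    have : ∀ᵐ q ∂(P.prod (volume.restrict (Ioc 0 t))), q.swap ∉ N :=
      Measure.measurePreserving_swap.quasiMeasurePreserving.ae (measure_eq_zero_iff_ae_notMem.mp hN0)
    exact Measure.ae_ae_of_ae_prod this
  have hrhs : ∫⁻ ω, (∫⁻ y in Ioi (0:ℝ), ENNReal.ofReal (hazardDensity (fun v => lam1 v ω) y) *
          ∫⁻ x in Ioi (0:ℝ), ENNReal.ofReal (hazardDensity (fun v => lam2 v ω) x) *
            N'.indicator 1 (ω, y, x)) ∂P = 0 := by
    refine lintegral_eq_zero_of_ae_eq_zero ?_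
    filter_upwards [hzero] with ω hω
    refine lintegral_eq_zero_of_ae_eq_zero ?_
    rw [Filter.EventuallyEq, ae_restrict_iff' measurableSet_Ioi]
    rw [ae_restrict_iff' measurableSet_Ioc] at hω
    filter_upwards [hω] with y hy hy0
    have : ∀ x, (ω, y, x) ∉ N' := fun x hx => hy ⟨hy0, hx.1⟩ hx.2
    simp [indicator_of_notMem (this _)]
  have hT : Measurable fun p : Ω × Ω' => (N'.indicator 1 : Ω × ℝ × ℝ → ℝ≥0∞)
      (p.1, hitTime (fun v => lam1 v p.1) (E₁ p.2), hitTime (fun v => lam2 v p.1) (E₂ p.2)) := by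
    refine (measurable_one.indicator hN'm).comp (measurable_fst.prodMk (Measurable.prodMk ?_ ?_))
    · exact (measurable_hitTime hm1 h01).comp ((hE₁.comp measurable_snd).prodMk measurable_fst)
    · exact (measurable_hitTime hm2 h02).comp ((hE₂.comp measurable_snd).prodMk measurable_fst)
  rw [hrhs, lintegral_eq_zero_iff hT] at hlaw
  filter_upwards [hlaw] with q hq hqt
  by_contra hcon
  have hmem : (q.1, hitTime (fun v => lam1 v q.1) (E₁ q.2),
      hitTime (fun v => lam2 v q.1) (E₂ q.2)) ∈ N' := ⟨hqt, subset_toMeasurable μ _ hcon⟩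
  rw [indicator_of_mem hmem] at hq
  exact one_ne_zero hq

end JointLaw

/-! ### The valuation identity, integrated over the default times -/

lemma measurable_indicator_one_ennreal {β : Type*} {m : MeasurableSpace β} {A : Set β}
    (hA : MeasurableSet[m] A) : Measurable[m] (A.indicator (1 : β → ℝ≥0∞)) :=
  measurable_one.indicator hA

section Valuation

variable {Ω : Type*} {mΩ : MeasurableSpace Ω} {P : Measure Ω}
  {F : Filtration ℝ mΩ} {lam1 lam2 : ℝ → Ω → ℝ}
  (hm1 : Measurable fun q : ℝ × Ω => lam1 q.1 q.2) (hm2 : Measurable fun q : ℝ × Ω => lam2 q.1 q.2)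

lemma aestronglyMeasurable_hazardDensity [IsFiniteMeasure P]
    (hm : Measurable fun q : ℝ × Ω => lam1 q.1 q.2)
    (ha : ∀ t, Measurable[F t] fun ω => lam1 t ω) {y t : ℝ} (hyt : y ≤ t) :
    AEStronglyMeasurable[F t] (fun ω => hazardDensity (fun v => lam1 v ω) y) P :=
  (Real.continuous_exp.comp_aestronglyMeasurable
    (aestronglyMeasurable_cumHazard hm ha hyt).neg).mul
    ((ha y).mono (F.mono hyt) le_rfl).aestronglyMeasurable

variable
  (h01 : ∀ v ω, 0 ≤ lam1 v ω) (h02 : ∀ v ω, 0 ≤ lam2 v ω)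
  (ha1 : ∀ t, Measurable[F t] fun ω => lam1 t ω)
  (h1 : ∀ᵐ ω ∂P, IsHazard fun v => lam1 v ω) (h2 : ∀ᵐ ω ∂P, IsHazard fun v => lam2 v ω)
  {Z : ℝ → Ω → ℝ} (hZ : Measurable fun q : ℝ × Ω => Z q.1 q.2) (hZ0 : ∀ u ω, 0 ≤ Z u ω)
  {M : ℝ} (hZM : ∀ u ω, Z u ω ≤ M) {t s : ℝ} (ht : 0 ≤ t) {g : ℝ × Ω → ℝ} (hg_meas : Measurable g)
  (hg : ∀ u : ℝ, 0 ≤ u → u ≤ t → (fun ω : Ω => g (u, ω)) =ᵐ[P]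
    P[fun ω : Ω => ∫ x in Ioc (t - u) (s - u),
      Z (u + x) ω * Real.exp (-(∫ w in Ioc (0:ℝ) x, lam2 w ω)) * lam2 x ω | F t])

section
include hm2 h02 hZ

lemma measurable_payoff_kernel : Measurable fun q : (ℝ × Ω) × ℝ =>
    Z (q.1.1 + q.2) q.1.2 * Real.exp (-(∫ w in Ioc (0:ℝ) q.2, lam2 w q.1.2)) * lam2 q.2 q.1.2 := by
  have e0 : Measurable fun q : (ℝ × Ω) × ℝ => (q.2, q.1.2) :=
    measurable_snd.prodMk measurable_fst.snd
  have e1 : Measurable fun q : (ℝ × Ω) × ℝ => Z (q.1.1 + q.2) q.1.2 :=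
    hZ.comp ((measurable_fst.fst.add measurable_snd).prodMk measurable_fst.snd)
  have e2 : Measurable fun q : (ℝ × Ω) × ℝ => cumHazard (fun v => lam2 v q.1.2) q.2 :=
    (measurable_cumHazard hm2 h02).comp e0
  have e3 : Measurable fun q : (ℝ × Ω) × ℝ => lam2 q.2 q.1.2 := hm2.comp e0
  exact (e1.mul e2.neg.exp).mul e3

include hm1 h01

lemma measurable_integral_payoff : Measurable fun ω => ∫ y in Ioc t s,
    (∫ x in Ioc (0:ℝ) (s - y),
      Z (y + x) ω * Real.exp (-(∫ w in Ioc (0:ℝ) x, lam2 w ω)) * lam2 x ω)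
      * Real.exp (-(∫ w in Ioc (0:ℝ) y, lam1 w ω)) * lam1 y ω := by
  have hk : Measurable fun q : Ω × ℝ => ∫ x in Ioc (0:ℝ) (s - q.2),
      Z (q.2 + x) q.1 * Real.exp (-(∫ w in Ioc (0:ℝ) x, lam2 w q.1)) * lam2 x q.1 :=
    (measurable_setIntegral_Ioc (measurable_payoff_kernel hm2 h02 hZ) measurable_const
      (measurable_const.sub measurable_fst)).comp measurable_swap
  refine measurable_setIntegral_Ioc (k := fun q : Ω × ℝ => (∫ x in Ioc (0:ℝ) (s - q.2),
      Z (q.2 + x) q.1 * Real.exp (-(∫ w in Ioc (0:ℝ) x, lam2 w q.1)) * lam2 x q.1)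
      * Real.exp (-(∫ w in Ioc (0:ℝ) q.2, lam1 w q.1)) * lam1 q.2 q.1) ?_ measurable_const
      measurable_const
  have e2 : Measurable fun q : Ω × ℝ => cumHazard (fun v => lam1 v q.1) q.2 :=
    (measurable_cumHazard hm1 h01).comp measurable_swap
  exact (hk.mul e2.neg.exp).mul (hm1.comp measurable_swap)

end

include h2 hZ hZ0 hZM

lemma ae_integral_payoff_mem_Icc {a b : ℝ} (ha : 0 ≤ a) (y : ℝ) : ∀ᵐ ω ∂P,
    ∫ x in Ioc a b, Z (y + x) ω * Real.exp (-(∫ w in Ioc (0:ℝ) x, lam2 w ω)) * lam2 x ω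
      ∈ Icc 0 M := by
  filter_upwards [h2] with ω hω2
  exact hω2.setIntegral_Ioc_mul_mem_Icc (W := fun x => Z (y + x) ω)
    (hZ.comp ((measurable_const_add y).prodMk measurable_const)) (fun _ => hZ0 _ _)
    (fun _ => hZM _ _) ha

section
include hm2 h02 h1 ht

lemma ae_integral_payoff_mem_Icc' : ∀ᵐ ω ∂P, ∫ y in Ioc t s,
    (∫ x in Ioc (0:ℝ) (s - y),
      Z (y + x) ω * Real.exp (-(∫ w in Ioc (0:ℝ) x, lam2 w ω)) * lam2 x ω)
      * Real.exp (-(∫ w in Ioc (0:ℝ) y, lam1 w ω)) * lam1 y ω ∈ Icc 0 M := by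
  filter_upwards [h1, h2] with ω hω1 hω2
  have hmem : ∀ y, ∫ x in Ioc (0:ℝ) (s - y),
      Z (y + x) ω * Real.exp (-(∫ w in Ioc (0:ℝ) x, lam2 w ω)) * lam2 x ω ∈ Icc 0 M := fun y =>
    hω2.setIntegral_Ioc_mul_mem_Icc (W := fun x => Z (y + x) ω)
      (hZ.comp ((measurable_const_add y).prodMk measurable_const)) (fun _ => hZ0 _ _)
      (fun _ => hZM _ _) le_rfl
  refine hω1.setIntegral_Ioc_mul_mem_Icc (W := fun y => ∫ x in Ioc (0:ℝ) (s - y),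
      Z (y + x) ω * Real.exp (-(∫ w in Ioc (0:ℝ) x, lam2 w ω)) * lam2 x ω) ?_
    (fun y => (hmem y).1) (fun y => (hmem y).2) ht
  exact (measurable_setIntegral_Ioc (measurable_payoff_kernel hm2 h02 hZ) measurable_const
    (measurable_const.sub measurable_fst)).comp (measurable_prodMk_right (y := ω))

end

variable [IsProbabilityMeasure P]
include hm2 h02

lemma integrable_integral_payoff {a b : ℝ} (ha : 0 ≤ a) (y : ℝ) : Integrable (fun ω =>
    ∫ x in Ioc a b, Z (y + x) ω * Real.exp (-(∫ w in Ioc (0:ℝ) x, lam2 w ω)) * lam2 x ω) P := by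
  refine Integrable.of_mem_Icc 0 M (Measurable.aemeasurable ?_)
    (ae_integral_payoff_mem_Icc h2 hZ hZ0 hZM ha y)
  exact (measurable_setIntegral_Ioc (measurable_payoff_kernel hm2 h02 hZ) measurable_const
    measurable_const).comp (measurable_prodMk_left (x := y))

include hm1 h01 h1 ht

lemma integrable_integral_payoff' : Integrable (fun ω => ∫ y in Ioc t s,
    (∫ x in Ioc (0:ℝ) (s - y),
      Z (y + x) ω * Real.exp (-(∫ w in Ioc (0:ℝ) x, lam2 w ω)) * lam2 x ω)
      * Real.exp (-(∫ w in Ioc (0:ℝ) y, lam1 w ω)) * lam1 y ω) P :=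
  Integrable.of_mem_Icc 0 M (measurable_integral_payoff hm1 hm2 h01 h02 hZ).aemeasurable
    (ae_integral_payoff_mem_Icc' hm2 h02 h1 h2 hZ hZ0 hZM ht)

include ha1 hg_meas hg

lemma lintegral_payoff_eq_lintegral_value {B : Set Ω} (hB : MeasurableSet[F t] B)
    {C : Set (ℝ × Ω)} (hC : MeasurableSet[Real.measurableSpace.prod (F t)] C) :
    ∫⁻ ω, (∫⁻ y in Ioi (0:ℝ), ENNReal.ofReal (hazardDensity (fun v => lam1 v ω) y) *
        ∫⁻ x in Ioi (0:ℝ), ENNReal.ofReal (hazardDensity (fun v => lam2 v ω) x) *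
          ((if t < y then B.indicator 1 ω else C.indicator 1 (y, ω)) *
            ENNReal.ofReal ((Ioc t s).indicator (fun u => Z u ω) (y + x)))) ∂P
      = ∫⁻ ω, (∫⁻ y in Ioi (0:ℝ), ENNReal.ofReal (hazardDensity (fun v => lam1 v ω) y) *
        ∫⁻ x in Ioi (0:ℝ), ENNReal.ofReal (hazardDensity (fun v => lam2 v ω) x) *
          ((if t < y then B.indicator 1 ω else C.indicator 1 (y, ω)) * ENNReal.ofReal
            (if t < y then Real.exp (cumHazard (fun v => lam1 v ω) t) * P[fun ω : Ω =>
                ∫ y in Ioc t s, (∫ x in Ioc (0:ℝ) (s - y),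
                  Z (y + x) ω * Real.exp (-(∫ w in Ioc (0:ℝ) x, lam2 w ω)) * lam2 x ω)
                  * Real.exp (-(∫ w in Ioc (0:ℝ) y, lam1 w ω)) * lam1 y ω | F t] ω
              else if t < y + x then
                Real.exp (cumHazard (fun v => lam2 v ω) (t - y)) * g (y, ω) else 0))) ∂P := by
  set I : Ω → ℝ := fun ω => ∫ y in Ioc t s, (∫ x in Ioc (0:ℝ) (s - y),
      Z (y + x) ω * Real.exp (-(∫ w in Ioc (0:ℝ) x, lam2 w ω)) * lam2 x ω)
      * Real.exp (-(∫ w in Ioc (0:ℝ) y, lam1 w ω)) * lam1 y ω with hI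
  set J : ℝ × Ω → ℝ := fun q => ∫ x in Ioc (t - q.1) (s - q.1),
      Z (q.1 + x) q.2 * Real.exp (-(∫ w in Ioc (0:ℝ) x, lam2 w q.2)) * lam2 x q.2 with hJ
  have hIm : Measurable I := measurable_integral_payoff hm1 hm2 h01 h02 hZ
  have hJm : Measurable J := measurable_setIntegral_Ioc (measurable_payoff_kernel hm2 h02 hZ)
    (measurable_const.sub measurable_fst) (measurable_const.sub measurable_fst)
  have hCm : MeasurableSet C := sup_le_sup le_rfl (MeasurableSpace.comap_mono (F.le t)) C hC
  have hBm : MeasurableSet B := F.le t B hB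
  have hPIm : Measurable (P[I | F t]) := (stronglyMeasurable_condExp.mono (F.le t)).measurable
  have hswap : ∀ {f : ℝ × Ω → ℝ}, Measurable f →
      ∫⁻ ω, (∫⁻ y in Ioc (0:ℝ) t, ENNReal.ofReal (hazardDensity (fun v => lam1 v ω) y) *
        (C.indicator 1 (y, ω) * ENNReal.ofReal (f (y, ω)))) ∂P
      = ∫⁻ y in Ioc (0:ℝ) t, (∫⁻ ω, (ENNReal.ofReal (hazardDensity (fun v => lam1 v ω) y) *
        C.indicator 1 (y, ω)) * ENNReal.ofReal (f (y, ω)) ∂P) := by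
    intro f hf
    have hmeas : Measurable fun q : ℝ × Ω =>
        ENNReal.ofReal (hazardDensity (fun v => lam1 v q.2) q.1) *
          (C.indicator 1 q * ENNReal.ofReal (f q)) :=
      (measurable_hazardDensity hm1 h01).ennreal_ofReal.mul
        ((measurable_one.indicator hCm).mul hf.ennreal_ofReal)
    simp only [mul_assoc]
    exact lintegral_lintegral_swap (hmeas.comp measurable_swap).aemeasurable
  calc _ = ∫⁻ ω, ((∫⁻ y in Ioc (0:ℝ) t, ENNReal.ofReal (hazardDensity (fun v => lam1 v ω) y) *
          (C.indicator 1 (y, ω) * ENNReal.ofReal (J (y, ω))))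
          + B.indicator 1 ω * ENNReal.ofReal (I ω)) ∂P := by
        refine lintegral_congr_ae ?_
        filter_upwards [h1, h2] with ω hω1 hω2
        exact lintegral_payoff_eq hω1 hω2 (hZ.comp measurable_prodMk_right) (fun u => hZ0 u ω)
          (fun u => hZM u ω) ht _ fun y => C.indicator 1 (y, ω)
    _ = ∫⁻ ω, ((∫⁻ y in Ioc (0:ℝ) t, ENNReal.ofReal (hazardDensity (fun v => lam1 v ω) y) *
          (C.indicator 1 (y, ω) * ENNReal.ofReal (g (y, ω))))
          + B.indicator 1 ω * ENNReal.ofReal (P[I | F t] ω)) ∂P := by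
        have hbI : Measurable fun ω => B.indicator 1 ω * ENNReal.ofReal (I ω) :=
          (measurable_one.indicator hBm).mul hIm.ennreal_ofReal
        have hbPI : Measurable fun ω => B.indicator 1 ω * ENNReal.ofReal (P[I | F t] ω) :=
          (measurable_one.indicator hBm).mul hPIm.ennreal_ofReal
        rw [lintegral_add_right _ hbI, lintegral_add_right _ hbPI, hswap hJm, hswap hg_meas]
        refine congrArg₂ (· + ·) ?_ ?_
        · refine setLIntegral_congr_fun measurableSet_Ioc fun y hy => ?_
          have hk : AEStronglyMeasurable[F t] (fun ω => ENNReal.ofReal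
              (hazardDensity (fun v => lam1 v ω) y) * C.indicator 1 (y, ω)) P := by
            obtain ⟨d, hd, hdd⟩ :=
              aestronglyMeasurable_hazardDensity (P := P) (F := F) hm1 ha1 hy.2
            have hCy : Measurable[F t] fun ω => (C.indicator 1 (y, ω) : ℝ≥0∞) :=
              Measurable.comp (measurable_indicator_one_ennreal hC) (@measurable_prodMk_left ℝ Ω _ (F t) y)
            refine ⟨fun ω => ENNReal.ofReal (d ω) * C.indicator 1 (y, ω),
              (hd.measurable.ennreal_ofReal.mul hCy).stronglyMeasurable, ?_⟩
            filter_upwards [hdd] with ω hω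
            rw [hω]
          have hty : 0 ≤ t - y := by linarith [hy.2]
          refine (lintegral_mul_ofReal_condExp (F.le t) hk
            (integrable_integral_payoff hm2 h02 h2 hZ hZ0 hZM (b := s - y) hty y)
            ((ae_integral_payoff_mem_Icc h2 hZ hZ0 hZM hty y).mono
              fun ω hω => hω.1)).symm.trans (lintegral_congr_ae ?_)
          filter_upwards [hg y hy.1.le hy.2] with ω hω
          rw [hω]
        · exact (lintegral_mul_ofReal_condExp (F.le t)
            (measurable_indicator_one_ennreal hB).stronglyMeasurable.aestronglyMeasurable
            (integrable_integral_payoff' hm1 hm2 h01 h02 h1 h2 hZ hZ0 hZM ht)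
            ((ae_integral_payoff_mem_Icc' hm2 h02 h1 h2 hZ hZ0 hZM ht).mono
              fun ω hω => hω.1)).symm
    _ = _ := by
        refine lintegral_congr_ae ?_
        filter_upwards [h1, h2] with ω hω1 hω2
        exact (lintegral_value_eq hω1 hω2 ht _ (fun y => C.indicator 1 (y, ω))
          (fun y => g (y, ω)) _).symm

end Valuation

/-! ### The filtration enlarged by the default indicators -/

section Enlargement

lemma exists_measurableSet_forall_mem_iff {α β : Type*} {m : MeasurableSpace α}
    {mβ : MeasurableSpace β} {f : α → β} {D : Set α}
    (h : m.comap ((↑) : D → α) ≤ mβ.comap fun d : D => f d) {A : Set α}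
    (hA : MeasurableSet[m] A) : ∃ C, MeasurableSet[mβ] C ∧ ∀ x ∈ D, (x ∈ A ↔ f x ∈ C) := by
  obtain ⟨C, hC, hCA⟩ := h _ ⟨A, hA, rfl⟩
  exact ⟨C, hC, fun x hx => (Set.ext_iff.mp hCA ⟨x, hx⟩).symm⟩

variable {Ω Ω' : Type*} {m : MeasurableSpace Ω} {τ1 τ2 : Ω × Ω' → ℝ} {t : ℝ}

/-- The σ-algebra generated by the events of `m` and by the default indicators up to time `t`. -/
abbrev defaultSigmaAlgebra (m : MeasurableSpace Ω) (τ1 τ2 : Ω × Ω' → ℝ) (t : ℝ) :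
    MeasurableSpace (Ω × Ω') :=
  MeasurableSpace.comap Prod.fst m
    ⊔ MeasurableSpace.generateFrom
        {A : Set (Ω × Ω') | ∃ u : ℝ, 0 ≤ u ∧ u ≤ t ∧ A = {q | τ1 q ≤ u}}
    ⊔ MeasurableSpace.generateFrom
        {A : Set (Ω × Ω') | ∃ u : ℝ, 0 ≤ u ∧ u ≤ t ∧ A = {q | τ2 q ≤ u}}

lemma measurable_fst_defaultSigmaAlgebra : Measurable[defaultSigmaAlgebra m τ1 τ2 t, m] Prod.fst :=
  fun B hB => (le_sup_left.trans le_sup_left : MeasurableSpace.comap Prod.fst m ≤ _) _ ⟨B, hB, rfl⟩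

lemma measurableSet_defaultSigmaAlgebra_fst {u : ℝ} (hu : 0 ≤ u) (hut : u ≤ t) :
    MeasurableSet[defaultSigmaAlgebra m τ1 τ2 t] {q | τ1 q ≤ u} :=
  (le_sup_right.trans le_sup_left : MeasurableSpace.generateFrom
    {A : Set (Ω × Ω') | ∃ u : ℝ, 0 ≤ u ∧ u ≤ t ∧ A = {q | τ1 q ≤ u}} ≤ _) _
    (MeasurableSpace.measurableSet_generateFrom ⟨u, hu, hut, rfl⟩)

lemma measurableSet_defaultSigmaAlgebra_snd {u : ℝ} (hu : 0 ≤ u) (hut : u ≤ t) :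
    MeasurableSet[defaultSigmaAlgebra m τ1 τ2 t] {q | τ2 q ≤ u} :=
  (le_sup_right : MeasurableSpace.generateFrom
    {A : Set (Ω × Ω') | ∃ u : ℝ, 0 ≤ u ∧ u ≤ t ∧ A = {q | τ2 q ≤ u}} ≤ _) _
    (MeasurableSpace.measurableSet_generateFrom ⟨u, hu, hut, rfl⟩)

lemma measurable_min_defaultSigmaAlgebra (h0 : ∀ q, 0 ≤ τ1 q) :
    Measurable[defaultSigmaAlgebra m τ1 τ2 t] fun q => min (τ1 q) t := by
  let _ := defaultSigmaAlgebra m τ1 τ2 t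
  refine measurable_of_Iic fun u => ?_
  rcases le_or_gt t u with hu | hu
  · convert @MeasurableSet.univ _ (defaultSigmaAlgebra m τ1 τ2 t)
    ext q
    simp [hu]
  rcases lt_or_ge u 0 with hu0 | hu0
  · convert @MeasurableSet.empty _ (defaultSigmaAlgebra m τ1 τ2 t)
    ext q
    simpa [hu] using hu0.trans_le (h0 q)
  · convert measurableSet_defaultSigmaAlgebra_fst (m := m) (τ1 := τ1) (τ2 := τ2) hu0 hu.le
    ext q
    simp [hu]

lemma defaultSigmaAlgebra_le {mΩ : MeasurableSpace Ω} {mΩ' : MeasurableSpace Ω'} (hm : m ≤ mΩ)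
    (h1 : Measurable τ1) (h2 : Measurable τ2) :
    defaultSigmaAlgebra m τ1 τ2 t ≤ mΩ.prod mΩ' := by
  refine sup_le (sup_le ?_ (MeasurableSpace.generateFrom_le ?_))
    (MeasurableSpace.generateFrom_le ?_)
  · exact (MeasurableSpace.comap_mono hm).trans le_sup_left
  · rintro _ ⟨u, -, -, rfl⟩
    exact measurableSet_le h1 measurable_const
  · rintro _ ⟨u, -, -, rfl⟩
    exact measurableSet_le h2 measurable_const

lemma comap_val_defaultSigmaAlgebra_le {D : Set (Ω × Ω')} {mD : MeasurableSpace D}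
    (hfst : Measurable[mD, m] fun d : D => (d : Ω × Ω').1)
    (h1 : ∀ u, 0 ≤ u → u ≤ t → MeasurableSet {d : D | τ1 d ≤ u})
    (h2 : ∀ u, 0 ≤ u → u ≤ t → MeasurableSet {d : D | τ2 d ≤ u}) :
    (defaultSigmaAlgebra m τ1 τ2 t).comap ((↑) : D → Ω × Ω') ≤ mD := by
  rw [MeasurableSpace.comap_le_iff_le_map]
  refine sup_le (sup_le ?_ (MeasurableSpace.generateFrom_le ?_))
    (MeasurableSpace.generateFrom_le ?_)
  · rintro _ ⟨B, hB, rfl⟩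
    exact hfst hB
  · rintro _ ⟨u, hu, hut, rfl⟩
    exact h1 u hu hut
  · rintro _ ⟨u, hu, hut, rfl⟩
    exact h2 u hu hut

variable (h12 : ∀ q, τ1 q ≤ τ2 q) {A : Set (Ω × Ω')}
  (hA : MeasurableSet[defaultSigmaAlgebra m τ1 τ2 t] A)
include h12 hA

lemma exists_measurableSet_before_first_default :
    ∃ B, MeasurableSet[m] B ∧ ∀ q, t < τ1 q → (q ∈ A ↔ q.1 ∈ B) := by
  refine exists_measurableSet_forall_mem_iff (D := {q | t < τ1 q})
    (comap_val_defaultSigmaAlgebra_le (fun B hB => ⟨B, hB, rfl⟩) (fun u hu hut => ?_)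
      fun u hu hut => ?_) hA
  · refine ⟨∅, @MeasurableSet.empty _ m, Eq.symm ?_⟩
    exact eq_empty_of_forall_notMem fun d (hd : τ1 d ≤ u) => absurd d.2 (hd.trans hut).not_gt
  · refine ⟨∅, @MeasurableSet.empty _ m, Eq.symm ?_⟩
    exact eq_empty_of_forall_notMem fun d (hd : τ2 d ≤ u) =>
      absurd d.2 ((h12 d).trans (hd.trans hut)).not_gt

omit h12 in
lemma exists_measurableSet_between_defaults :
    ∃ C, MeasurableSet[Real.measurableSpace.prod m] C ∧
      ∀ q, τ1 q ≤ t ∧ t < τ2 q → (q ∈ A ↔ (τ1 q, q.1) ∈ C) := by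
  refine exists_measurableSet_forall_mem_iff (D := {q | τ1 q ≤ t ∧ t < τ2 q})
    (f := fun q => (τ1 q, q.1))
    (comap_val_defaultSigmaAlgebra_le (fun B hB => ?_) (fun u hu hut => ?_) fun u hu hut => ?_) hA
  · exact ⟨Prod.snd ⁻¹' B, (@measurable_snd ℝ Ω _ m) hB, rfl⟩
  · exact ⟨Prod.fst ⁻¹' Iic u, (@measurable_fst ℝ Ω _ m) measurableSet_Iic, rfl⟩
  · refine ⟨∅, @MeasurableSet.empty _ _, Eq.symm ?_⟩
    exact eq_empty_of_forall_notMem fun d (hd : τ2 d ≤ u) => absurd d.2.2 (hd.trans hut).not_gt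

end Enlargement

lemma measurable_uncurry_of_isStronglyProgressive {Ω : Type*} {mΩ : MeasurableSpace Ω}
    {F : Filtration ℝ mΩ} {Z : ℝ → Ω → ℝ} (hZ : IsStronglyProgressive F Z) :
    Measurable fun q : ℝ × Ω => Z q.1 q.2 := by
  refine measurable_of_tendsto_metrizable (f := fun (n : ℕ) (q : ℝ × Ω) => Z (min q.1 n) q.2)
    (fun n => ?_) (tendsto_pi_nhds.mpr fun q => ?_)
  · have h1 := (hZ (n : ℝ)).measurable
    have h2 : Measurable[_, Subtype.instMeasurableSpace.prod (F (n : ℝ))] fun q : ℝ × Ω =>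
        ((⟨min q.1 n, mem_Iic.mpr (min_le_right _ _)⟩ : Iic (n : ℝ)), q.2) := by
      refine @Measurable.prodMk _ _ _ _ _ (F (n : ℝ)) _ _ ?_ ?_
      · exact (measurable_fst.min measurable_const).subtype_mk
      · exact measurable_snd.mono le_rfl (F.le _)
    exact h1.comp h2
  · obtain ⟨N, hN⟩ := exists_nat_ge q.1
    refine tendsto_const_nhds.congr' ?_
    filter_upwards [Filter.eventually_ge_atTop N] with n hn
    rw [min_eq_left (hN.trans (Nat.cast_le.mpr hn))]

/-- equation (eq:secondPayoffi=2) of Lemma 6.3 of the paper: valuation of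
the payment `Z` at the second default time under a fixed prior, two-default Cox model.
`Ω'` plays the role of `Ω̂`, `Phat` of `P̂`, `lam1, lam2` of `λ̃¹, λ̃²`, `τ1 = τ̃_1 = τ_1`,
`τ'2 = τ̃_2`, `τ2 = τ_2 = τ̃_1 + τ̃_2`; `𝓗ⁱ_t` is generated by the events `{τ_i ≤ u}`,
`0 ≤ u ≤ t`, `𝒢_t^{(2)} = 𝓕_t ∨ 𝓗¹_t ∨ 𝓗²_t`, and `g` is a jointly measurable version of
the parametrized `𝓕_t`-conditional expectations
`u ↦ E^P[∫_{t−u}^{s−u} Z_{u+x} e^{−∫_0^x λ̃²} λ̃²_x dx | 𝓕_t]`. -/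
theorem stmt_19
    {Ω Ω' : Type*} [mΩ : MeasurableSpace Ω] [mΩ' : MeasurableSpace Ω']
    (P : Measure Ω) (Phat : Measure Ω')
    [IsProbabilityMeasure P] [IsProbabilityMeasure Phat]
    (F : Filtration ℝ mΩ) (hF : (⨆ t : ℝ, (F t : MeasurableSpace Ω)) = mΩ)
    (E₁ E₂ : Ω' → ℝ) (hE₁ : Measurable E₁) (hE₂ : Measurable E₂)
    (hEindep : IndepFun E₁ E₂ Phat)
    (hE₁exp : ∀ x : ℝ, 0 ≤ x → Phat {y | x < E₁ y} = ENNReal.ofReal (Real.exp (-x)))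
    (hE₂exp : ∀ x : ℝ, 0 ≤ x → Phat {y | x < E₂ y} = ENNReal.ofReal (Real.exp (-x)))
    (lam1 lam2 : ℝ → Ω → ℝ)
    (hlam1_meas : Measurable fun q : ℝ × Ω => lam1 q.1 q.2)
    (hlam2_meas : Measurable fun q : ℝ × Ω => lam2 q.1 q.2)
    (hlam1_nonneg : ∀ s ω, 0 ≤ lam1 s ω) (hlam2_nonneg : ∀ s ω, 0 ≤ lam2 s ω)
    (hlam1_adapted : ∀ t, Measurable[F t] fun ω => lam1 t ω)
    (hlam2_adapted : ∀ t, Measurable[F t] fun ω => lam2 t ω)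
    (hlam1_int : ∀ᵐ ω ∂P,
      (∀ t : ℝ, ∫⁻ v in Set.Ioc (0:ℝ) t, ENNReal.ofReal (lam1 v ω) < ⊤) ∧
      (∫⁻ v in Set.Ioi (0:ℝ), ENNReal.ofReal (lam1 v ω) = ⊤))
    (hlam2_int : ∀ᵐ ω ∂P,
      (∀ t : ℝ, ∫⁻ v in Set.Ioc (0:ℝ) t, ENNReal.ofReal (lam2 v ω) < ⊤) ∧
      (∫⁻ v in Set.Ioi (0:ℝ), ENNReal.ofReal (lam2 v ω) = ⊤))
    (τ1 τ'2 τ2 : Ω × Ω' → ℝ)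
    (hτ1 : ∀ p, τ1 p
      = sInf {u : ℝ | 0 < u ∧ E₁ p.2 ≤ ∫ v in Set.Ioc (0:ℝ) u, lam1 v p.1})
    (hτ'2 : ∀ p, τ'2 p
      = sInf {u : ℝ | 0 < u ∧ E₂ p.2 ≤ ∫ v in Set.Ioc (0:ℝ) u, lam2 v p.1})
    (hτ2 : ∀ p, τ2 p = τ1 p + τ'2 p)
    (Z : ℝ → Ω → ℝ) (hZ_prog : ProgMeasurable F Z)
    (hZ_nonneg : ∀ u ω, 0 ≤ Z u ω) (hZ_bdd : ∃ C : ℝ, ∀ u ω, Z u ω ≤ C)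
    (t s : ℝ) (ht : 0 ≤ t) (hts : t ≤ s)
    (g : ℝ × Ω → ℝ) (hg_meas : Measurable g)
    (hg : ∀ u : ℝ, 0 ≤ u → u ≤ t →
      (fun ω : Ω => g (u, ω))
        =ᵐ[P]
      P[fun ω : Ω =>
          ∫ x in Set.Ioc (t - u) (s - u),
            Z (u + x) ω * Real.exp (-(∫ w in Set.Ioc (0:ℝ) x, lam2 w ω)) * lam2 x ω |
        F t]) :
    (P.prod Phat)[Set.indicator {p : Ω × Ω' | t < τ2 p ∧ τ2 p ≤ s}
          (fun p => Z (τ2 p) p.1) |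
        MeasurableSpace.comap Prod.fst (F t)
          ⊔ MeasurableSpace.generateFrom
              {A : Set (Ω × Ω') | ∃ u : ℝ, 0 ≤ u ∧ u ≤ t ∧ A = {q | τ1 q ≤ u}}
          ⊔ MeasurableSpace.generateFrom
              {A : Set (Ω × Ω') | ∃ u : ℝ, 0 ≤ u ∧ u ≤ t ∧ A = {q | τ2 q ≤ u}}]
      =ᵐ[P.prod Phat]
    fun p : Ω × Ω' =>
      Set.indicator {q : Ω × Ω' | t < τ1 q}
          (fun q =>
            Real.exp (∫ v in Set.Ioc (0:ℝ) t, lam1 v q.1)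
              * (P[fun ω : Ω =>
                    ∫ y in Set.Ioc t s,
                      (∫ x in Set.Ioc (0:ℝ) (s - y),
                          Z (y + x) ω * Real.exp (-(∫ w in Set.Ioc (0:ℝ) x, lam2 w ω))
                            * lam2 x ω)
                        * Real.exp (-(∫ w in Set.Ioc (0:ℝ) y, lam1 w ω)) * lam1 y ω |
                  F t]) q.1) p
      + Set.indicator {q : Ω × Ω' | τ1 q ≤ t ∧ t < τ2 q}
          (fun q =>
            Real.exp (∫ v in Set.Ioc (0:ℝ) (t - τ1 q), lam2 v q.1)
              * g (τ1 q, q.1)) p := by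
  obtain ⟨M, hM⟩ := hZ_bdd
  have hZ := measurable_uncurry_of_isStronglyProgressive hZ_prog
  have h1 : ∀ᵐ ω ∂P, IsHazard fun v => lam1 v ω := hlam1_int.mono fun ω h =>
    ⟨hlam1_meas.comp measurable_prodMk_right, fun v => hlam1_nonneg v ω, h.1, h.2⟩
  have h2 : ∀ᵐ ω ∂P, IsHazard fun v => lam2 v ω := hlam2_int.mono fun ω h =>
    ⟨hlam2_meas.comp measurable_prodMk_right, fun v => hlam2_nonneg v ω, h.1, h.2⟩
  have hτ1h : τ1 = fun p => hitTime (fun v => lam1 v p.1) (E₁ p.2) := funext hτ1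
  have hτ'2h : τ'2 = fun p => hitTime (fun v => lam2 v p.1) (E₂ p.2) := funext hτ'2
  have hlaw : ∀ {φ : Ω × ℝ × ℝ → ℝ≥0∞}, Measurable φ →
      ∫⁻ p, φ (p.1, τ1 p, τ'2 p) ∂(P.prod Phat)
        = ∫⁻ ω, (∫⁻ y in Ioi (0:ℝ), ENNReal.ofReal (hazardDensity (fun v => lam1 v ω) y) *
            ∫⁻ x in Ioi (0:ℝ), ENNReal.ofReal (hazardDensity (fun v => lam2 v ω) x) *
              φ (ω, y, x)) ∂P := by
    intro φ hφ
    rw [hτ1h, hτ'2h]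
    exact lintegral_hitTime_hitTime hE₁ hE₂ hEindep hE₁exp hE₂exp
      hlam1_meas hlam2_meas hlam1_nonneg hlam2_nonneg h1 h2 hφ
  have hae : ∀ {p : ℝ × Ω → Prop}, (∀ᵐ q ∂((volume.restrict (Ioc 0 t)).prod P), p q) →
      ∀ᵐ q ∂(P.prod Phat), τ1 q ≤ t → p (τ1 q, q.1) := by
    intro p hp
    rw [hτ1h]
    exact ae_of_ae_prod_of_hitTime_le hE₁ hE₂ hEindep hE₁exp
      hE₂exp hlam1_meas hlam2_meas hlam1_nonneg hlam2_nonneg h1 h2 hp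
  have hτ1m : Measurable τ1 := by
    rw [hτ1h]
    exact (measurable_hitTime hlam1_meas hlam1_nonneg).comp
      ((hE₁.comp measurable_snd).prodMk measurable_fst)
  have hτ'2m : Measurable τ'2 := by
    rw [hτ'2h]
    exact (measurable_hitTime hlam2_meas hlam2_nonneg).comp
      ((hE₂.comp measurable_snd).prodMk measurable_fst)
  have hτ10 : ∀ p, 0 ≤ τ1 p := fun p => by rw [hτ1h]; exact hitTime_nonneg _ _
  have h12 : ∀ p, τ1 p ≤ τ2 p := fun p => by
    rw [hτ2 p, hτ'2h]; exact le_add_of_nonneg_right (hitTime_nonneg _ _)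
  have hτ2m : Measurable τ2 := by rw [funext hτ2]; exact hτ1m.add hτ'2m
  clear hτ1h hτ'2h hτ1 hτ'2
  set I : Ω → ℝ := fun ω => ∫ y in Ioc t s, (∫ x in Ioc (0:ℝ) (s - y),
      Z (y + x) ω * Real.exp (-(∫ w in Ioc (0:ℝ) x, lam2 w ω)) * lam2 x ω)
      * Real.exp (-(∫ w in Ioc (0:ℝ) y, lam1 w ω)) * lam1 y ω with hI
  have hPI0 : 0 ≤ᵐ[P] P[I | F t] := condExp_nonneg
    ((ae_integral_payoff_mem_Icc' hlam2_meas hlam2_nonneg h1 h2 hZ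
      hZ_nonneg hM ht).mono fun ω hω => hω.1)
  have hcore := fun B hB C hC => lintegral_payoff_eq_lintegral_value (B := B) (C := C) (s := s)
    hlam1_meas hlam2_meas hlam1_nonneg hlam2_nonneg hlam1_adapted h1 h2 hZ hZ_nonneg hM ht hg_meas
    hg hB hC
  have hPIm : Measurable[F t] (P[I | F t]) := stronglyMeasurable_condExp.measurable
  have hg0 : ∀ᵐ q ∂((volume.restrict (Ioc 0 t)).prod P), 0 ≤ g q := by
    rw [Measure.ae_prod_iff_ae_ae (measurableSet_le measurable_const hg_meas)]
    filter_upwards [ae_restrict_mem measurableSet_Ioc] with u hu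
    have h0 := condExp_nonneg (m := F t) ((ae_integral_payoff_mem_Icc h2 hZ
      hZ_nonneg hM (b := s - u) (sub_nonneg.mpr hu.2) u).mono fun ω hω => hω.1)
    filter_upwards [hg u hu.1.le hu.2, h0] with ω hω hω0
    rw [hω]
    exact hω0
  change (P.prod Phat)[_ | defaultSigmaAlgebra (F t) τ1 τ2 t] =ᵐ[P.prod Phat] _
  have hG : defaultSigmaAlgebra (F t) τ1 τ2 t ≤ Prod.instMeasurableSpace :=
    defaultSigmaAlgebra_le (F.le t) hτ1m hτ2m
  set X : Ω × Ω' → ℝ := indicator {p : Ω × Ω' | t < τ2 p ∧ τ2 p ≤ s} fun p => Z (τ2 p) p.1 with hX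
  set R : Ω × Ω' → ℝ := fun p =>
      indicator {q : Ω × Ω' | t < τ1 q} (fun q =>
        Real.exp (∫ v in Ioc (0:ℝ) t, lam1 v q.1) * (P[I | F t]) q.1) p
      + indicator {q : Ω × Ω' | τ1 q ≤ t ∧ t < τ2 q} (fun q =>
        Real.exp (∫ v in Ioc (0:ℝ) (t - τ1 q), lam2 v q.1) * g (τ1 q, q.1)) p with hR
  have hXm : Measurable X := by
    refine Measurable.indicator (hZ.comp (hτ2m.prodMk measurable_fst)) ?_
    exact (measurableSet_lt measurable_const hτ2m).inter (measurableSet_le hτ2m measurable_const)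
  have hX0 : ∀ p, 0 ≤ X p := fun p => indicator_nonneg (fun _ _ => hZ_nonneg _ _) p
  have hXM : ∀ p, X p ≤ M := fun p =>
    indicator_le' (fun _ _ => hM _ _) (fun _ _ => (hZ_nonneg 0 p.1).trans (hM 0 p.1)) p
  have hXint : Integrable X (P.prod Phat) :=
    Integrable.of_mem_Icc 0 M hXm.aemeasurable (ae_of_all _ fun p => ⟨hX0 p, hXM p⟩)
  have hRG : AEStronglyMeasurable[defaultSigmaAlgebra (F t) τ1 τ2 t] R (P.prod Phat) := by
    have hτ1G := measurableSet_defaultSigmaAlgebra_fst (m := F t) (τ1 := τ1) (τ2 := τ2) ht le_rfl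
    have hτ2G := measurableSet_defaultSigmaAlgebra_snd (m := F t) (τ1 := τ1) (τ2 := τ2) ht le_rfl
    have hminG := measurable_min_defaultSigmaAlgebra (m := F t) (τ2 := τ2) (t := t) hτ10
    have hfstG : Measurable[defaultSigmaAlgebra (F t) τ1 τ2 t, F t] Prod.fst :=
      measurable_fst_defaultSigmaAlgebra
    refine AEStronglyMeasurable.add ?_ ?_
    · obtain ⟨d, hd, hdd⟩ :=
        aestronglyMeasurable_cumHazard (P := P) hlam1_meas hlam1_adapted (le_refl t)
      have hset : {q | t < τ1 q} = {q | τ1 q ≤ t}ᶜ := by ext q; simp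
      refine ⟨indicator {q | t < τ1 q} fun q => Real.exp (d q.1) * (P[I | F t]) q.1,
        StronglyMeasurable.indicator ?_ (hset ▸ hτ1G.compl), ?_⟩
      · exact ((hd.measurable.exp.mul hPIm).comp hfstG).stronglyMeasurable
      · filter_upwards [Measure.quasiMeasurePreserving_fst.ae hdd] with q hq
        by_cases hmem : t < τ1 q
        · rw [indicator_of_mem (show q ∈ {q | t < τ1 q} from hmem),
            indicator_of_mem (show q ∈ {q | t < τ1 q} from hmem), ← hq]
          rfl
        · rw [indicator_of_notMem (show q ∉ {q | t < τ1 q} from hmem),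
            indicator_of_notMem (show q ∉ {q | t < τ1 q} from hmem)]
    · obtain ⟨k, hk, hhk⟩ := aestronglyMeasurable_prod_of_sections (m := F t) (P := P)
        (ν := volume.restrict (Ioc 0 t)) (F.le t)
        (h := fun q => Real.exp (cumHazard (fun v => lam2 v q.2) (t - q.1)) * g q)
        ((((measurable_cumHazard hlam2_meas hlam2_nonneg).comp
          ((measurable_const.sub measurable_fst).prodMk measurable_snd)).exp).mul hg_meas) (by
          filter_upwards [ae_restrict_mem measurableSet_Ioc] with y hy
          refine (Real.continuous_exp.comp_aestronglyMeasurable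
            (aestronglyMeasurable_cumHazard hlam2_meas hlam2_adapted (by linarith [hy.1]))).mul ?_
          exact stronglyMeasurable_condExp.aestronglyMeasurable.congr (hg y hy.1.le hy.2).symm)
      have hset : {q | τ1 q ≤ t ∧ t < τ2 q} = {q | τ1 q ≤ t} ∩ {q | τ2 q ≤ t}ᶜ := by ext q; simp
      refine ⟨indicator {q | τ1 q ≤ t ∧ t < τ2 q} fun q => k (min (τ1 q) t, q.1),
        StronglyMeasurable.indicator ?_ (hset ▸ hτ1G.inter hτ2G.compl), ?_⟩
      · exact (hk.measurable.comp
          (@Measurable.prodMk _ _ _ _ _ (F t) _ _ hminG hfstG)).stronglyMeasurable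
      · filter_upwards [hae hhk] with q hq
        by_cases hmem : τ1 q ≤ t ∧ t < τ2 q
        · rw [indicator_of_mem (show q ∈ {q | τ1 q ≤ t ∧ t < τ2 q} from hmem),
            indicator_of_mem (show q ∈ {q | τ1 q ≤ t ∧ t < τ2 q} from hmem), min_eq_left hmem.1]
          exact hq hmem.1
        · rw [indicator_of_notMem (show q ∉ {q | τ1 q ≤ t ∧ t < τ2 q} from hmem),
            indicator_of_notMem (show q ∉ {q | τ1 q ≤ t ∧ t < τ2 q} from hmem)]
  have hR0 : 0 ≤ᵐ[P.prod Phat] R := by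
    filter_upwards [hae hg0, Measure.quasiMeasurePreserving_fst.ae hPI0] with p hp1 hp2
    refine add_nonneg (indicator_apply_nonneg fun _ => ?_) (indicator_apply_nonneg fun h => ?_)
    · exact mul_nonneg (Real.exp_pos _).le hp2
    · exact mul_nonneg (Real.exp_pos _).le (hp1 h.1)
  have hkey : ∀ A, MeasurableSet[defaultSigmaAlgebra (F t) τ1 τ2 t] A →
      ∫⁻ p in A, ENNReal.ofReal (R p) ∂(P.prod Phat)
        = ∫⁻ p in A, ENNReal.ofReal (X p) ∂(P.prod Phat) := by
    intro A hA
    obtain ⟨B, hB, hAB⟩ := exists_measurableSet_before_first_default h12 hA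
    obtain ⟨C, hC, hAC⟩ := exists_measurableSet_between_defaults hA
    have hCm : MeasurableSet C := sup_le_sup le_rfl (MeasurableSpace.comap_mono (F.le t)) C hC
    set K : Ω × ℝ × ℝ → ℝ≥0∞ := fun q =>
      if t < q.2.1 then B.indicator 1 q.1 else C.indicator 1 (q.2.1, q.1) with hK
    have hKm : Measurable K := by
      refine Measurable.ite (measurableSet_lt measurable_const measurable_snd.fst) ?_ ?_
      · exact (measurable_one.indicator (F.le t B hB)).comp measurable_fst
      · exact (measurable_one.indicator hCm).comp (measurable_snd.fst.prodMk measurable_fst)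
    have hKA : ∀ {r : Ω × Ω' → ℝ} {r' : ℝ} {p : Ω × Ω'}, (τ2 p ≤ t → r p = 0) → r p = r' →
        A.indicator (fun p => ENNReal.ofReal (r p)) p
          = K (p.1, τ1 p, τ'2 p) * ENNReal.ofReal r' := by
      rintro r _ p hr rfl
      rcases le_or_gt (τ2 p) t with hp | hp
      · simp [hr hp, indicator]
      rcases lt_or_ge t (τ1 p) with hp1 | hp1
      · have h := hAB p hp1
        by_cases hpA : p ∈ A
        · simp [hK, hp1, hpA, h.mp hpA]
        · have hpB : p.1 ∉ B := fun hB => hpA (h.mpr hB)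
          simp [hK, hp1, hpA, hpB]
      · have h := hAC p ⟨hp1, hp⟩
        by_cases hpA : p ∈ A
        · simp [hK, hp1.not_gt, hpA, h.mp hpA]
        · have hpC : (τ1 p, p.1) ∉ C := fun hC => hpA (h.mpr hC)
          simp [hK, hp1.not_gt, hpA, hpC]
    have hXK : ∀ p, A.indicator (fun p => ENNReal.ofReal (X p)) p = K (p.1, τ1 p, τ'2 p) *
        ENNReal.ofReal ((Ioc t s).indicator (fun u => Z u p.1) (τ1 p + τ'2 p)) := fun p => by
      refine hKA (fun hp => indicator_of_notMem (fun h => hp.not_gt h.1) _) ?_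
      rw [← hτ2 p]
      rfl
    have hRK : ∀ p, A.indicator (fun p => ENNReal.ofReal (R p)) p = K (p.1, τ1 p, τ'2 p) *
        ENNReal.ofReal (if t < τ1 p then
            Real.exp (cumHazard (fun v => lam1 v p.1) t) * (P[I | F t]) p.1
          else if t < τ1 p + τ'2 p then
            Real.exp (cumHazard (fun v => lam2 v p.1) (t - τ1 p)) * g (τ1 p, p.1) else 0) := by
      intro p
      have h := h12 p
      refine hKA (fun hp => ?_) ?_
      · simp [hR, hp.not_gt, (h.trans hp).not_gt]
      · rw [← hτ2 p]
        rcases lt_or_ge t (τ1 p) with hp1 | hp1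
        · simp [hR, hp1, hp1.not_ge, cumHazard]
        · by_cases hp : t < τ2 p <;> simp [hR, hp1, hp1.not_gt, hp, cumHazard]
    rw [← lintegral_indicator (hG A hA), ← lintegral_indicator (hG A hA), lintegral_congr hXK,
      lintegral_congr hRK]
    refine (hlaw (φ := fun q => K q * ENNReal.ofReal (if t < q.2.1 then
            Real.exp (cumHazard (fun v => lam1 v q.1) t) * (P[I | F t]) q.1
          else if t < q.2.1 + q.2.2 then
            Real.exp (cumHazard (fun v => lam2 v q.1) (t - q.2.1)) * g (q.2.1, q.1) else 0)) ?_).trans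
      ((hcore B hB C hC).symm.trans (hlaw (φ := fun q => K q *
        ENNReal.ofReal ((Ioc t s).indicator (fun u => Z u q.1) (q.2.1 + q.2.2))) ?_).symm)
    · refine hKm.mul (Measurable.ennreal_ofReal (Measurable.ite
        (measurableSet_lt measurable_const measurable_snd.fst) ?_ (Measurable.ite
        (measurableSet_lt measurable_const (measurable_snd.fst.add measurable_snd.snd)) ?_
        measurable_const)))
      · exact ((measurable_cumHazard hlam1_meas hlam1_nonneg).comp
          (measurable_const.prodMk measurable_fst)).exp.mul
          ((hPIm.mono (F.le t) le_rfl).comp measurable_fst)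
      · exact ((measurable_cumHazard hlam2_meas hlam2_nonneg).comp
          ((measurable_const.sub measurable_snd.fst).prodMk measurable_fst)).exp.mul
          (hg_meas.comp (measurable_snd.fst.prodMk measurable_fst))
    · refine hKm.mul (Measurable.ennreal_ofReal ?_)
      have hsum : Measurable fun q : Ω × ℝ × ℝ => q.2.1 + q.2.2 :=
        measurable_snd.fst.add measurable_snd.snd
      exact (hZ.comp (hsum.prodMk measurable_fst)).indicator (hsum measurableSet_Ioc)
  have hRint : Integrable R (P.prod Phat) := by
    refine ⟨hRG.mono hG, ?_⟩
    rw [hasFiniteIntegral_iff_ofReal hR0]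
    have h := hkey univ MeasurableSet.univ
    rw [setLIntegral_univ, setLIntegral_univ] at h
    rw [h, ← hasFiniteIntegral_iff_ofReal (ae_of_all _ hX0)]
    exact hXint.2
  refine (ae_eq_condExp_of_forall_setIntegral_eq hG hXint (fun _ _ _ => hRint.integrableOn)
    (fun A hA _ => ?_) hRG).symm
  rw [integral_eq_lintegral_of_nonneg_ae (ae_restrict_of_ae hR0) hRint.1.restrict,
    integral_eq_lintegral_of_nonneg_ae (ae_of_all _ hX0) hXm.aestronglyMeasurable, hkey A hA]
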